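/- Let γ be a probability measure on ℝ³ that is the weak limit, as n → ∞, of the measures ν_n^0. Then for every real ν > 0 and every Schwartz function f : ℝ³ → ℝ, Ent_γ(f²) ≤ 2ν(e^{1/ν} − 1) ∫_{ℝ³} ( (Xf)² + (Yf)² + ν (Zf)² ) dγ. -/

import Mathlib

open MeasureTheory ProbabilityTheory

noncomputable section

/-- The Heisenberg group as ℝ³. -/
abbrev H : Type := ℝ × ℝ × ℝ

/-- Entropy of `f` with respect to `μ`. -/
def Ent {α : Type*} [MeasurableSpace α] (μ : Measure α) (f : α → ℝ) : ℝ :=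
  ∫ a, f a * Real.log (f a) ∂μ - (∫ a, f a ∂μ) * Real.log (∫ a, f a ∂μ)

/-- Partial derivative in the first coordinate. -/
def pdx (f : H → ℝ) (p : H) : ℝ := deriv (fun t => f (t, p.2.1, p.2.2)) p.1

/-- Partial derivative in the second coordinate. -/
def pdy (f : H → ℝ) (p : H) : ℝ := deriv (fun t => f (p.1, t, p.2.2)) p.2.1

/-- Partial derivative in the third coordinate. -/
def pdz (f : H → ℝ) (p : H) : ℝ := deriv (fun t => f (p.1, p.2.1, t)) p.2.2

/-- The left-invariant vector field `X`. -/
def Xop (f : H → ℝ) (p : H) : ℝ := pdx f p - p.2.1 / 2 * pdz f p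

/-- The left-invariant vector field `Y`. -/
def Yop (f : H → ℝ) (p : H) : ℝ := pdy f p + p.1 / 2 * pdz f p

/-- The left-invariant vector field `Z`. -/
def Zop (f : H → ℝ) (p : H) : ℝ := pdz f p

/-- The standard Gaussian measure on ℝ³. -/
def stdGauss3 : Measure H :=
  (gaussianReal 0 1).prod ((gaussianReal 0 1).prod (gaussianReal 0 1))

/-- The standard Gaussian measure N(0, I_{3n}) on (ℝ³)^n. -/
def gaussN (n : ℕ) : Measure (Fin n → H) := Measure.pi fun _ => stdGauss3

/-- `s_{n,k}^β` : the `k`-th step of the Heisenberg random walk built from `n` increments. -/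
def snk (β : ℝ) (n k : ℕ) (v : Fin n → H) : H :=
  ((n : ℝ) ^ (-(1:ℝ)/2) * ∑ i : Fin n, (if i.val < k then (v i).1 else 0),
   (n : ℝ) ^ (-(1:ℝ)/2) * ∑ i : Fin n, (if i.val < k then (v i).2.1 else 0),
   β * (n : ℝ) ^ (-(1:ℝ)/2) * ∑ i : Fin n, (if i.val < k then (v i).2.2 else 0)
     + (2 * (n : ℝ))⁻¹ * ∑ i : Fin n, ∑ j : Fin n,
        (if i.val < j.val ∧ j.val < k then
          (v i).1 * (v j).2.1 - (v i).2.1 * (v j).1 else 0))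

/-- `ν_n^β` : the law of the Heisenberg random walk at its `n`-th step. -/
def nuMeas (β : ℝ) (n : ℕ) : Measure H := (gaussN n).map (snk β n n)

open scoped LineDeriv SchwartzMap

/-- The Heisenberg group law in exponential coordinates. -/
def hmul (p q : H) : H :=
  (p.1 + q.1, p.2.1 + q.2.1, p.2.2 + q.2.2 + (p.1 * q.2.1 - p.2.1 * q.1) / 2)

lemma hmul_assoc (p q r : H) : hmul (hmul p q) r = hmul p (hmul q r) := by
  ext <;> simp [hmul] <;> ring

lemma hmul_zero (p : H) : hmul p 0 = p := by ext <;> simp [hmul]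

lemma continuous_hmul : Continuous fun x : H × H => hmul x.1 x.2 := by
  unfold hmul; fun_prop

/-- Conjugating a horizontal increment past a group element. -/
lemma hmul_conj (h s : H) (a b : ℝ) :
    hmul (hmul h (a, b, 0)) s = hmul (hmul h s) (a, b, a * s.2.1 - b * s.1) := by
  ext <;> simp [hmul] <;> ring

/-- The left-invariant vector field `X` acting on Schwartz functions. -/
def schwartzX (g : 𝓢(H, ℝ)) : 𝓢(H, ℝ) :=
  ∂_{((1, 0, 0) : H)} g
    - SchwartzMap.smulLeftCLM ℝ (fun p : H => p.2.1 / 2) (∂_{((0, 0, 1) : H)} g)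

/-- The left-invariant vector field `Y` acting on Schwartz functions. -/
def schwartzY (g : 𝓢(H, ℝ)) : 𝓢(H, ℝ) :=
  ∂_{((0, 1, 0) : H)} g
    + SchwartzMap.smulLeftCLM ℝ (fun p : H => p.1 / 2) (∂_{((0, 0, 1) : H)} g)

/-- The left-invariant vector field `Z` acting on Schwartz functions. -/
def schwartzZ (g : 𝓢(H, ℝ)) : 𝓢(H, ℝ) := ∂_{((0, 0, 1) : H)} g

lemma hasTemperateGrowth_snd_half : Function.HasTemperateGrowth (fun p : H => p.2.1 / 2) := by
  have : (fun p : H => p.2.1 / 2) = ⇑((1 / 2 : ℝ) •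
      ((ContinuousLinearMap.fst ℝ ℝ ℝ).comp (ContinuousLinearMap.snd ℝ ℝ (ℝ × ℝ)))) := by
    ext p; simp; ring
  rw [this]
  exact ContinuousLinearMap.hasTemperateGrowth _

lemma hasTemperateGrowth_fst_half : Function.HasTemperateGrowth (fun p : H => p.1 / 2) := by
  have : (fun p : H => p.1 / 2) = ⇑((1 / 2 : ℝ) • (ContinuousLinearMap.fst ℝ ℝ (ℝ × ℝ))) := by
    ext p; simp; ring
  rw [this]
  exact ContinuousLinearMap.hasTemperateGrowth _

lemma schwartzX_apply (g : 𝓢(H, ℝ)) (p : H) :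
    schwartzX g p = fderiv ℝ g p (1, 0, -(p.2.1 / 2)) := by
  have e : ((1, 0, -(p.2.1 / 2)) : H) = (1, 0, 0) - (p.2.1 / 2) • (0, 0, 1) := by
    ext <;> simp
  rw [e, map_sub, map_smul, schwartzX, sub_apply,
    SchwartzMap.smulLeftCLM_apply_apply hasTemperateGrowth_snd_half,
    SchwartzMap.lineDerivOp_apply_eq_fderiv, SchwartzMap.lineDerivOp_apply_eq_fderiv]

lemma schwartzY_apply (g : 𝓢(H, ℝ)) (p : H) :
    schwartzY g p = fderiv ℝ g p (0, 1, p.1 / 2) := by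
  have e : ((0, 1, p.1 / 2) : H) = (0, 1, 0) + (p.1 / 2) • (0, 0, 1) := by
    ext <;> simp
  rw [e, map_add, map_smul, schwartzY, add_apply,
    SchwartzMap.smulLeftCLM_apply_apply hasTemperateGrowth_fst_half,
    SchwartzMap.lineDerivOp_apply_eq_fderiv, SchwartzMap.lineDerivOp_apply_eq_fderiv]

lemma schwartzZ_apply (g : 𝓢(H, ℝ)) (p : H) :
    schwartzZ g p = fderiv ℝ g p (0, 0, 1) := by
  rw [schwartzZ, SchwartzMap.lineDerivOp_apply_eq_fderiv]

lemma Xop_schwartz (g : 𝓢(H, ℝ)) (p : H) : Xop g p = schwartzX g p := by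
  have e : ((1, 0, -(p.2.1 / 2)) : H) = (1, 0, 0) - (p.2.1 / 2) • (0, 0, 1) := by
    ext <;> simp
  have h1 : HasDerivAt (fun t : ℝ => ((t, p.2.1, p.2.2) : H)) (1, 0, 0) p.1 :=
    (hasDerivAt_id _).prodMk ((hasDerivAt_const _ _).prodMk (hasDerivAt_const _ _))
  have h3 : HasDerivAt (fun t : ℝ => ((p.1, p.2.1, t) : H)) (0, 0, 1) p.2.2 :=
    (hasDerivAt_const _ _).prodMk ((hasDerivAt_const _ _).prodMk (hasDerivAt_id _))
  have k1 := ((g.hasFDerivAt p).comp_hasDerivAt p.1 h1).deriv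
  have k3 := ((g.hasFDerivAt p).comp_hasDerivAt p.2.2 h3).deriv
  rw [schwartzX_apply, e, map_sub, map_smul, ← k1, ← k3]
  rfl

lemma Yop_schwartz (g : 𝓢(H, ℝ)) (p : H) : Yop g p = schwartzY g p := by
  have e : ((0, 1, p.1 / 2) : H) = (0, 1, 0) + (p.1 / 2) • (0, 0, 1) := by
    ext <;> simp
  have h1 : HasDerivAt (fun t : ℝ => ((p.1, t, p.2.2) : H)) (0, 1, 0) p.2.1 :=
    (hasDerivAt_const _ _).prodMk ((hasDerivAt_id _).prodMk (hasDerivAt_const _ _))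
  have h3 : HasDerivAt (fun t : ℝ => ((p.1, p.2.1, t) : H)) (0, 0, 1) p.2.2 :=
    (hasDerivAt_const _ _).prodMk ((hasDerivAt_const _ _).prodMk (hasDerivAt_id _))
  have k1 := ((g.hasFDerivAt p).comp_hasDerivAt p.2.1 h1).deriv
  have k3 := ((g.hasFDerivAt p).comp_hasDerivAt p.2.2 h3).deriv
  rw [schwartzY_apply, e, map_add, map_smul, ← k1, ← k3]
  rfl

lemma Zop_schwartz (g : 𝓢(H, ℝ)) (p : H) : Zop g p = schwartzZ g p := by
  have h3 : HasDerivAt (fun t : ℝ => ((p.1, p.2.1, t) : H)) (0, 0, 1) p.2.2 :=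
    (hasDerivAt_const _ _).prodMk ((hasDerivAt_const _ _).prodMk (hasDerivAt_id _))
  have k3 := ((g.hasFDerivAt p).comp_hasDerivAt p.2.2 h3).deriv
  rw [schwartzZ_apply, ← k3]
  rfl

lemma fderiv_schwartz_split (g : 𝓢(H, ℝ)) (q k : H) :
    fderiv ℝ g q (k.1, k.2.1, k.2.2 + (q.1 * k.2.1 - q.2.1 * k.1) / 2) =
      k.1 * schwartzX g q + k.2.1 * schwartzY g q + k.2.2 * schwartzZ g q := by
  have e : ((k.1, k.2.1, k.2.2 + (q.1 * k.2.1 - q.2.1 * k.1) / 2) : H) =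
      k.1 • ((1, 0, -(q.2.1 / 2)) : H) + k.2.1 • ((0, 1, q.1 / 2) : H)
        + k.2.2 • ((0, 0, 1) : H) := by
    ext <;> simp
    ring
  rw [schwartzX_apply, schwartzY_apply, schwartzZ_apply, e]
  simp only [map_add, map_smul, smul_eq_mul]

/-- Differentiation along one-parameter subgroups. -/
lemma hasDerivAt_schwartz_hmul (g : 𝓢(H, ℝ)) (p k : H) (t : ℝ) :
    HasDerivAt (fun t : ℝ => g (hmul p (t • k)))
      (k.1 * schwartzX g (hmul p (t • k)) + k.2.1 * schwartzY g (hmul p (t • k))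
        + k.2.2 * schwartzZ g (hmul p (t • k))) t := by
  have h1 : HasDerivAt (fun t : ℝ => hmul p (t • k))
      (k.1, k.2.1, k.2.2 + (p.1 * k.2.1 - p.2.1 * k.1) / 2) t := by
    have : (fun t : ℝ => hmul p (t • k)) = fun t =>
        p + t • ((k.1, k.2.1, k.2.2 + (p.1 * k.2.1 - p.2.1 * k.1) / 2) : H) := by
      ext t <;> simp [hmul]
      ring
    rw [this]
    simpa using ((hasDerivAt_id t).smul_const
      ((k.1, k.2.1, k.2.2 + (p.1 * k.2.1 - p.2.1 * k.1) / 2) : H)).const_add p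
  have h2 := (g.hasFDerivAt (hmul p (t • k))).comp_hasDerivAt t h1
  rw [← fderiv_schwartz_split]
  convert! h2 using 2
  ext <;> simp [hmul]
  ring

lemma fderiv_fderiv_apply (g : 𝓢(H, ℝ)) (v : H → H) (v' : H →L[ℝ] H) (p k : H)
    (hv : HasFDerivAt v v' p) :
    fderiv ℝ (fun q => fderiv ℝ g q (v q)) p k =
      fderiv ℝ (fderiv ℝ g) p k (v p) + fderiv ℝ g p (v' k) := by
  have hd : DifferentiableAt ℝ (fderiv ℝ g) p :=
    ((g.smooth 2).fderiv_right (m := 1) (by norm_num)).differentiable (by norm_num) p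
  rw [(hd.hasFDerivAt.clm_apply hv).fderiv]
  simp [add_comm]

lemma fderiv_schwartzX (g : 𝓢(H, ℝ)) (p k : H) :
    fderiv ℝ (schwartzX g) p k =
      fderiv ℝ (fderiv ℝ g) p k (1, 0, -(p.2.1 / 2))
        + fderiv ℝ g p (0, 0, -(k.2.1 / 2)) := by
  have e : ⇑(schwartzX g) = fun q => fderiv ℝ g q (1, 0, -(q.2.1 / 2)) :=
    funext (schwartzX_apply g)
  have hv : HasFDerivAt (fun q : H => ((1, 0, -(q.2.1 / 2)) : H))
      ((0 : H →L[ℝ] ℝ).prod ((0 : H →L[ℝ] ℝ).prod (-((1 / 2 : ℝ) •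
        ((ContinuousLinearMap.fst ℝ ℝ ℝ).comp (ContinuousLinearMap.snd ℝ ℝ (ℝ × ℝ))))))) p := by
    refine (hasFDerivAt_const _ _).prodMk ((hasFDerivAt_const _ _).prodMk ?_)
    refine HasFDerivAt.neg ?_
    convert! (((1 / 2 : ℝ) • ((ContinuousLinearMap.fst ℝ ℝ ℝ).comp
      (ContinuousLinearMap.snd ℝ ℝ (ℝ × ℝ)))).hasFDerivAt (x := p)) using 1
    ext q; simp; ring
  rw [e, fderiv_fderiv_apply g _ _ p k hv]
  congr 2
  ext <;> simp
  ring

lemma fderiv_schwartzY (g : 𝓢(H, ℝ)) (p k : H) :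
    fderiv ℝ (schwartzY g) p k =
      fderiv ℝ (fderiv ℝ g) p k (0, 1, p.1 / 2) + fderiv ℝ g p (0, 0, k.1 / 2) := by
  have e : ⇑(schwartzY g) = fun q => fderiv ℝ g q (0, 1, q.1 / 2) :=
    funext (schwartzY_apply g)
  have hv : HasFDerivAt (fun q : H => ((0, 1, q.1 / 2) : H))
      ((0 : H →L[ℝ] ℝ).prod ((0 : H →L[ℝ] ℝ).prod ((1 / 2 : ℝ) •
        (ContinuousLinearMap.fst ℝ ℝ (ℝ × ℝ))))) p := by
    refine (hasFDerivAt_const _ _).prodMk ((hasFDerivAt_const _ _).prodMk ?_)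
    convert! (((1 / 2 : ℝ) • (ContinuousLinearMap.fst ℝ ℝ (ℝ × ℝ))).hasFDerivAt (x := p)) using 1
    ext q; simp; ring
  rw [e, fderiv_fderiv_apply g _ _ p k hv]
  congr 2
  ext <;> simp
  ring

lemma fderiv_schwartzZ (g : 𝓢(H, ℝ)) (p k : H) :
    fderiv ℝ (schwartzZ g) p k = fderiv ℝ (fderiv ℝ g) p k (0, 0, 1) := by
  have e : ⇑(schwartzZ g) = fun q => fderiv ℝ g q (0, 0, 1) := funext (schwartzZ_apply g)
  rw [e, fderiv_fderiv_apply g _ _ p k (hasFDerivAt_const ((0, 0, 1) : H) p)]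
  simp

lemma schwartz_fderiv_symm (g : 𝓢(H, ℝ)) (p v w : H) :
    fderiv ℝ (fderiv ℝ g) p v w = fderiv ℝ (fderiv ℝ g) p w v :=
  ((g.contDiffAt 2).isSymmSndFDerivAt (by simp)) v w

/-- The bracket relation `[X, Y] = Z`. -/
lemma schwartzX_schwartzY (g : 𝓢(H, ℝ)) (p : H) :
    schwartzX (schwartzY g) p = schwartzY (schwartzX g) p + schwartzZ g p := by
  rw [schwartzX_apply, schwartzY_apply (schwartzX g), schwartzZ_apply, fderiv_schwartzX,
    fderiv_schwartzY, schwartz_fderiv_symm, add_assoc, ← map_add]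
  congr 2
  ext <;> simp
  norm_num

lemma schwartzZ_schwartzX (g : 𝓢(H, ℝ)) (p : H) :
    schwartzZ (schwartzX g) p = schwartzX (schwartzZ g) p := by
  rw [schwartzX_apply, schwartzZ_apply, fderiv_schwartzX, fderiv_schwartzZ,
    schwartz_fderiv_symm]
  have : ((0, 0, -(0 / 2)) : H) = 0 := by ext <;> simp
  simp only [this, map_zero, add_zero]

lemma schwartzZ_schwartzY (g : 𝓢(H, ℝ)) (p : H) :
    schwartzZ (schwartzY g) p = schwartzY (schwartzZ g) p := by
  rw [schwartzY_apply, schwartzZ_apply, fderiv_schwartzY, fderiv_schwartzZ,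
    schwartz_fderiv_symm]
  have : ((0, 0, 0 / 2) : H) = 0 := by ext <;> simp
  simp only [this, map_zero, add_zero]

/-- The pointwise product of two Schwartz functions. -/
def schwartzMul (f g : 𝓢(H, ℝ)) : 𝓢(H, ℝ) :=
  SchwartzMap.smulLeftCLM ℝ f g

lemma schwartzMul_apply (f g : 𝓢(H, ℝ)) (p : H) : schwartzMul f g p = f p * g p := by
  rw [schwartzMul, SchwartzMap.smulLeftCLM_apply_apply f.hasTemperateGrowth, smul_eq_mul]

lemma fderiv_schwartzMul_self (f : 𝓢(H, ℝ)) (p k : H) :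
    fderiv ℝ (schwartzMul f f) p k = 2 * f p * fderiv ℝ f p k := by
  have e : ⇑(schwartzMul f f) = ⇑f * ⇑f := funext (schwartzMul_apply f f)
  rw [e, ((f.hasFDerivAt p).mul (f.hasFDerivAt p)).fderiv]
  simp
  ring

lemma schwartz_bounded (g : 𝓢(H, ℝ)) : ∃ K, 0 ≤ K ∧ ∀ p, |g p| ≤ K :=
  ⟨_, apply_nonneg _ _, fun p => SchwartzMap.norm_le_seminorm ℝ g p⟩

/-- A first-order Taylor estimate along left translations. -/
lemma schwartz_lipschitz (g : 𝓢(H, ℝ)) : ∃ K, 0 ≤ K ∧ ∀ p k : H,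
    |g (hmul p k) - g p| ≤ K * (|k.1| + |k.2.1| + |k.2.2|) := by
  obtain ⟨K1, h1, b1⟩ := schwartz_bounded (schwartzX g)
  obtain ⟨K2, h2, b2⟩ := schwartz_bounded (schwartzY g)
  obtain ⟨K3, h3, b3⟩ := schwartz_bounded (schwartzZ g)
  refine ⟨K1 + K2 + K3, by positivity, fun p k => ?_⟩
  have key := Convex.norm_image_sub_le_of_norm_hasDerivWithin_le
    (f := fun t : ℝ => g (hmul p (t • k))) (s := Set.univ) (x := 0) (y := 1)
    (C := (K1 + K2 + K3) * (|k.1| + |k.2.1| + |k.2.2|))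
    (fun t _ => (hasDerivAt_schwartz_hmul g p k t).hasDerivWithinAt) ?_ convex_univ
    (Set.mem_univ _) (Set.mem_univ _)
  · simpa [hmul_zero] using key
  · intro t _
    set q := hmul p (t • k)
    have e1 : |k.1 * schwartzX g q| ≤ |k.1| * K1 := by
      rw [abs_mul]; exact mul_le_mul_of_nonneg_left (b1 q) (abs_nonneg _)
    have e2 : |k.2.1 * schwartzY g q| ≤ |k.2.1| * K2 := by
      rw [abs_mul]; exact mul_le_mul_of_nonneg_left (b2 q) (abs_nonneg _)
    have e3 : |k.2.2 * schwartzZ g q| ≤ |k.2.2| * K3 := by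
      rw [abs_mul]; exact mul_le_mul_of_nonneg_left (b3 q) (abs_nonneg _)
    rw [Real.norm_eq_abs]
    refine (abs_add_three _ _ _).trans ?_
    have := abs_nonneg k.1
    have := abs_nonneg k.2.1
    have := abs_nonneg k.2.2
    nlinarith [mul_nonneg h1 (abs_nonneg k.2.1), mul_nonneg h1 (abs_nonneg k.2.2),
      mul_nonneg h2 (abs_nonneg k.1), mul_nonneg h2 (abs_nonneg k.2.2),
      mul_nonneg h3 (abs_nonneg k.1), mul_nonneg h3 (abs_nonneg k.2.1)]

/-- A second-order Taylor estimate along left translations. -/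
lemma schwartz_taylor (g : 𝓢(H, ℝ)) : ∃ K, 0 ≤ K ∧ ∀ p k : H,
    |g (hmul p k) - g p - (k.1 * schwartzX g p + k.2.1 * schwartzY g p + k.2.2 * schwartzZ g p)|
      ≤ K * (|k.1| + |k.2.1| + |k.2.2|) ^ 2 := by
  obtain ⟨K1, h1, b1⟩ := schwartz_lipschitz (schwartzX g)
  obtain ⟨K2, h2, b2⟩ := schwartz_lipschitz (schwartzY g)
  obtain ⟨K3, h3, b3⟩ := schwartz_lipschitz (schwartzZ g)
  refine ⟨K1 + K2 + K3, by positivity, fun p k => ?_⟩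
  set d := k.1 * schwartzX g p + k.2.1 * schwartzY g p + k.2.2 * schwartzZ g p with hd
  set A := |k.1| + |k.2.1| + |k.2.2| with hA
  have key := Convex.norm_image_sub_le_of_norm_hasDerivWithin_le
    (f := fun t : ℝ => g (hmul p (t • k)) - t * d) (s := Set.Icc 0 1) (x := 0) (y := 1)
    (C := (K1 + K2 + K3) * A ^ 2)
    (fun t _ => ((hasDerivAt_schwartz_hmul g p k t).sub
      ((hasDerivAt_id t).mul_const d)).hasDerivWithinAt) ?_ (convex_Icc 0 1)
    (by simp) (by simp)
  · simp only [one_smul, one_mul, zero_smul, hmul_zero, zero_mul, sub_zero, norm_one,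
      mul_one, Real.norm_eq_abs] at key
    convert! key using 2
    ring
  · intro t ht
    set q := hmul p (t • k) with hq
    have bd : |(t • k).1| + |(t • k).2.1| + |(t • k).2.2| ≤ A := by
      simp only [Prod.smul_fst, Prod.smul_snd, smul_eq_mul, abs_mul, abs_of_nonneg ht.1, hA]
      nlinarith [abs_nonneg k.1, abs_nonneg k.2.1, abs_nonneg k.2.2, ht.2]
    have A0 : 0 ≤ A := by positivity
    have c1 : |k.1| ≤ A := by rw [hA]; linarith [abs_nonneg k.1, abs_nonneg k.2.1, abs_nonneg k.2.2]
    have c2 : |k.2.1| ≤ A := by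
      rw [hA]; linarith [abs_nonneg k.1, abs_nonneg k.2.1, abs_nonneg k.2.2]
    have c3 : |k.2.2| ≤ A := by
      rw [hA]; linarith [abs_nonneg k.1, abs_nonneg k.2.1, abs_nonneg k.2.2]
    have e1 : |k.1 * (schwartzX g q - schwartzX g p)| ≤ A * (K1 * A) := by
      rw [abs_mul]
      exact mul_le_mul c1 ((b1 p (t • k)).trans (mul_le_mul_of_nonneg_left bd h1))
        (abs_nonneg _) A0
    have e2 : |k.2.1 * (schwartzY g q - schwartzY g p)| ≤ A * (K2 * A) := by
      rw [abs_mul]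
      exact mul_le_mul c2 ((b2 p (t • k)).trans (mul_le_mul_of_nonneg_left bd h2))
        (abs_nonneg _) A0
    have e3 : |k.2.2 * (schwartzZ g q - schwartzZ g p)| ≤ A * (K3 * A) := by
      rw [abs_mul]
      exact mul_le_mul c3 ((b3 p (t • k)).trans (mul_le_mul_of_nonneg_left bd h3))
        (abs_nonneg _) A0
    rw [Real.norm_eq_abs]
    calc _ = |k.1 * (schwartzX g q - schwartzX g p) + k.2.1 * (schwartzY g q - schwartzY g p)
          + k.2.2 * (schwartzZ g q - schwartzZ g p)| := by congr 1; rw [hd]; ring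
      _ ≤ _ := (abs_add_three _ _ _).trans (by nlinarith)

/-- The standard Gaussian measure on the plane. -/
def planeGauss : Measure (ℝ × ℝ) := (gaussianReal 0 1).prod (gaussianReal 0 1)

instance : IsProbabilityMeasure planeGauss := by unfold planeGauss; infer_instance

/-- A polynomial weight on the plane. -/
def rad (w : ℝ × ℝ) : ℝ := 1 + |w.1| + |w.2|

lemma one_le_rad (w : ℝ × ℝ) : 1 ≤ rad w := by
  unfold rad; linarith [abs_nonneg w.1, abs_nonneg w.2]

lemma abs_fst_le_rad (w : ℝ × ℝ) : |w.1| ≤ rad w := by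
  unfold rad; linarith [abs_nonneg w.1, abs_nonneg w.2]

lemma abs_snd_le_rad (w : ℝ × ℝ) : |w.2| ≤ rad w := by
  unfold rad; linarith [abs_nonneg w.1, abs_nonneg w.2]

lemma rad_pow_le (w : ℝ × ℝ) {k : ℕ} (hk : k ≤ 6) : rad w ^ k ≤ rad w ^ 6 :=
  pow_le_pow_right₀ (one_le_rad w) hk

lemma memLp_fst_planeGauss (p : ENNReal) (hp : p ≠ ⊤) :
    MemLp (fun w : ℝ × ℝ => w.1) p planeGauss :=
  (memLp_id_gaussianReal' p hp).comp_fst _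

lemma memLp_snd_planeGauss (p : ENNReal) (hp : p ≠ ⊤) :
    MemLp (fun w : ℝ × ℝ => w.2) p planeGauss :=
  (memLp_id_gaussianReal' p hp).comp_snd _

lemma integrable_rad_pow : Integrable (fun w => rad w ^ 6) planeGauss := by
  have h₀ : MemLp (fun _ : ℝ × ℝ => (1 : ℝ)) 6 planeGauss := memLp_const 1
  have h₁ : MemLp (fun w : ℝ × ℝ => |w.1|) 6 planeGauss :=
    (memLp_fst_planeGauss 6 (by norm_num)).norm
  have h₂ : MemLp (fun w : ℝ × ℝ => |w.2|) 6 planeGauss :=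
    (memLp_snd_planeGauss 6 (by norm_num)).norm
  have h : MemLp rad 6 planeGauss := (h₀.add h₁).add h₂
  have := h.integrable_norm_pow (p := 6) (by norm_num)
  refine this.congr (Filter.Eventually.of_forall fun w => ?_)
  simp only [Real.norm_eq_abs]
  rw [abs_of_nonneg (by linarith [one_le_rad w])]

/-- The sixth moment of the weight `rad`. -/
def radMoment : ℝ := ∫ w, rad w ^ 6 ∂planeGauss

lemma radMoment_nonneg : 0 ≤ radMoment :=
  integral_nonneg fun w => by have := one_le_rad w; positivity

lemma integrable_of_le_rad {φ : ℝ × ℝ → ℝ} (hm : Measurable φ) (C : ℝ)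
    (h : ∀ w, |φ w| ≤ C * rad w ^ 6) : Integrable φ planeGauss :=
  (integrable_rad_pow.const_mul C).mono' hm.aestronglyMeasurable
    (Filter.Eventually.of_forall h)

lemma abs_integral_le_rad {φ : ℝ × ℝ → ℝ} (C : ℝ)
    (h : ∀ w, |φ w| ≤ C * rad w ^ 6) : |∫ w, φ w ∂planeGauss| ≤ C * radMoment := by
  have := norm_integral_le_of_norm_le (f := φ) (integrable_rad_pow.const_mul C)
    (Filter.Eventually.of_forall h)
  rwa [integral_const_mul] at this

lemma integrable_of_bounded {φ : ℝ × ℝ → ℝ} (hm : Measurable φ) (C : ℝ)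
    (h : ∀ w, |φ w| ≤ C) : Integrable φ planeGauss :=
  Integrable.of_bound hm.aestronglyMeasurable C (Filter.Eventually.of_forall h)

lemma integral_sq_gaussian : ∫ x, x ^ 2 ∂(gaussianReal 0 1) = 1 := by
  have h := variance_fun_id_gaussianReal (μ := 0) (v := 1)
  rw [variance_eq_integral (by fun_prop)] at h
  simpa [integral_id_gaussianReal] using h

lemma integral_fst_planeGauss : ∫ w, w.1 ∂planeGauss = 0 := by
  have := integral_fun_fst (μ := gaussianReal 0 1) (ν := gaussianReal 0 1) (fun x : ℝ => x)
  simpa [planeGauss, integral_id_gaussianReal] using this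

lemma integral_snd_planeGauss : ∫ w, w.2 ∂planeGauss = 0 := by
  have := integral_fun_snd (μ := gaussianReal 0 1) (ν := gaussianReal 0 1) (fun x : ℝ => x)
  simpa [planeGauss, integral_id_gaussianReal] using this

lemma integral_fst_sq_planeGauss : ∫ w, w.1 ^ 2 ∂planeGauss = 1 := by
  have := integral_fun_fst (μ := gaussianReal 0 1) (ν := gaussianReal 0 1) (fun x : ℝ => x ^ 2)
  simpa [planeGauss, integral_sq_gaussian] using this

lemma integral_snd_sq_planeGauss : ∫ w, w.2 ^ 2 ∂planeGauss = 1 := by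
  have := integral_fun_snd (μ := gaussianReal 0 1) (ν := gaussianReal 0 1) (fun x : ℝ => x ^ 2)
  simpa [planeGauss, integral_sq_gaussian] using this

lemma integral_fst_mul_snd_planeGauss : ∫ w, w.1 * w.2 ∂planeGauss = 0 := by
  have := integral_prod_mul (μ := gaussianReal 0 1) (ν := gaussianReal 0 1)
    (fun x : ℝ => x) (fun x : ℝ => x)
  simpa [planeGauss, integral_id_gaussianReal] using this

lemma integrable_fst : Integrable (fun w : ℝ × ℝ => w.1) planeGauss :=
  (memLp_fst_planeGauss 1 (by norm_num)).integrable le_rfl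

lemma integrable_snd : Integrable (fun w : ℝ × ℝ => w.2) planeGauss :=
  (memLp_snd_planeGauss 1 (by norm_num)).integrable le_rfl

lemma integrable_fst_sq : Integrable (fun w : ℝ × ℝ => w.1 ^ 2) planeGauss :=
  (memLp_fst_planeGauss 2 (by norm_num)).integrable_sq

lemma integrable_snd_sq : Integrable (fun w : ℝ × ℝ => w.2 ^ 2) planeGauss :=
  (memLp_snd_planeGauss 2 (by norm_num)).integrable_sq

lemma integrable_fst_mul_snd : Integrable (fun w : ℝ × ℝ => w.1 * w.2) planeGauss :=
  (memLp_fst_planeGauss 2 (by norm_num)).integrable_mul (memLp_snd_planeGauss 2 (by norm_num))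

/-- Integrals of quadratic polynomials against the standard Gaussian measure. -/
lemma integral_quadratic (a₀ a₁ a₂ a₃ a₄ a₅ : ℝ) :
    Integrable (fun w : ℝ × ℝ => a₀ + a₁ * w.1 + a₂ * w.2 + a₃ * w.1 ^ 2 + a₄ * w.2 ^ 2
      + a₅ * (w.1 * w.2)) planeGauss ∧
    ∫ w, a₀ + a₁ * w.1 + a₂ * w.2 + a₃ * w.1 ^ 2 + a₄ * w.2 ^ 2 + a₅ * (w.1 * w.2) ∂planeGauss
      = a₀ + a₃ + a₄ := by
  have i0 : Integrable (fun _ : ℝ × ℝ => a₀) planeGauss := integrable_const _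
  have i1 := integrable_fst.const_mul a₁
  have i2 := integrable_snd.const_mul a₂
  have i3 := integrable_fst_sq.const_mul a₃
  have i4 := integrable_snd_sq.const_mul a₄
  have i5 := integrable_fst_mul_snd.const_mul a₅
  have j1 : Integrable (fun w : ℝ × ℝ => a₀ + a₁ * w.1) planeGauss := i0.add i1
  have j2 : Integrable (fun w : ℝ × ℝ => a₀ + a₁ * w.1 + a₂ * w.2) planeGauss := j1.add i2
  have j3 : Integrable (fun w : ℝ × ℝ => a₀ + a₁ * w.1 + a₂ * w.2 + a₃ * w.1 ^ 2) planeGauss :=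
    j2.add i3
  have j4 : Integrable (fun w : ℝ × ℝ => a₀ + a₁ * w.1 + a₂ * w.2 + a₃ * w.1 ^ 2
      + a₄ * w.2 ^ 2) planeGauss := j3.add i4
  refine ⟨j4.add i5, ?_⟩
  rw [integral_add j4 i5, integral_add j3 i4, integral_add j2 i3, integral_add j1 i2,
    integral_add i0 i1]
  simp only [integral_const_mul, integral_const, integral_fst_planeGauss,
    integral_snd_planeGauss, integral_fst_sq_planeGauss, integral_snd_sq_planeGauss,
    integral_fst_mul_snd_planeGauss]
  simp

/-- A centred quadratic weight does not see the value at the centre of a Lipschitz function. -/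
lemma abs_integral_centered_mul_le {p ρ : ℝ × ℝ → ℝ} (hp : Integrable p planeGauss)
    (hpm : Measurable p) (hρm : Measurable ρ) (hp0 : ∫ w, p w ∂planeGauss = 0) {M L ρ₀ : ℝ}
    (hM : 0 ≤ M) (hpb : ∀ w, |p w| ≤ M * rad w ^ 2)
    (hρ : ∀ w, |ρ w - ρ₀| ≤ L * rad w) :
    |∫ w, p w * ρ w ∂planeGauss| ≤ M * L * radMoment := by
  have b : ∀ w, |p w * (ρ w - ρ₀)| ≤ M * L * rad w ^ 6 := fun w => by
    have r1 := one_le_rad w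
    have hL : 0 ≤ L * rad w := (abs_nonneg _).trans (hρ w)
    have hL0 : 0 ≤ L := nonneg_of_mul_nonneg_left hL (by linarith)
    rw [abs_mul]
    calc |p w| * |ρ w - ρ₀| ≤ (M * rad w ^ 2) * (L * rad w) :=
          mul_le_mul (hpb w) (hρ w) (abs_nonneg _) (by positivity)
      _ = M * L * rad w ^ 3 := by ring
      _ ≤ _ := mul_le_mul_of_nonneg_left (rad_pow_le w (by norm_num)) (by positivity)
  have e : ∫ w, p w * ρ w ∂planeGauss = ∫ w, p w * (ρ w - ρ₀) ∂planeGauss := by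
    have : (fun w => p w * ρ w) = fun w => p w * (ρ w - ρ₀) + p w * ρ₀ := by
      ext w; ring
    rw [this, integral_add (integrable_of_le_rad (by fun_prop) _ b) (hp.mul_const _),
      integral_mul_const, hp0, zero_mul, add_zero]
  rw [e]
  exact abs_integral_le_rad _ b

/-- Pairing a linear weight with a function close to an affine one. -/
lemma abs_integral_linear_mul_sub_le {p u : ℝ × ℝ → ℝ} {a b c K u₀ m₁ m₂ : ℝ}
    (hpm : Measurable p) (hp : ∀ w, p w = m₁ * w.1 + m₂ * w.2) (hpb : ∀ w, |p w| ≤ rad w)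
    (hu : Measurable u)
    (h : ∀ w, |u w - u₀ - c * (a * w.1 + b * w.2)| ≤ K * rad w ^ 2) :
    Integrable (fun w => p w * u w) planeGauss ∧
    |∫ w, p w * u w ∂planeGauss - c * (m₁ * a + m₂ * b)| ≤ K * radMoment := by
  have bd : ∀ w, |p w * (u w - u₀ - c * (a * w.1 + b * w.2))| ≤ K * rad w ^ 6 := fun w => by
    have r1 := one_le_rad w
    have hK : 0 ≤ K := nonneg_of_mul_nonneg_left ((abs_nonneg _).trans (h w)) (by positivity)
    rw [abs_mul]
    calc _ ≤ rad w * (K * rad w ^ 2) :=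
          mul_le_mul (hpb w) (h w) (abs_nonneg _) (by linarith)
      _ = K * rad w ^ 3 := by ring
      _ ≤ _ := mul_le_mul_of_nonneg_left (rad_pow_le w (by norm_num)) hK
  obtain ⟨qi, qe⟩ := integral_quadratic 0 (m₁ * u₀) (m₂ * u₀) (c * (m₁ * a)) (c * (m₂ * b))
    (c * (m₁ * b + m₂ * a))
  have i1 := integrable_of_le_rad (by fun_prop) _ bd
  have e : (fun w => p w * u w) = fun w => p w * (u w - u₀ - c * (a * w.1 + b * w.2)) +
      (0 + m₁ * u₀ * w.1 + m₂ * u₀ * w.2 + c * (m₁ * a) * w.1 ^ 2 + c * (m₂ * b) * w.2 ^ 2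
        + c * (m₁ * b + m₂ * a) * (w.1 * w.2)) := by
    ext w; rw [hp]; ring
  rw [e]
  refine ⟨i1.add qi, ?_⟩
  rw [integral_add i1 qi, qe]
  convert! abs_integral_le_rad _ bd using 2
  ring

/-- The norm of a vector for the metric `a² + b² + ν d²`. -/
def nrm (ν a b d : ℝ) : ℝ := √(a ^ 2 + b ^ 2 + ν * d ^ 2)

lemma nrm_nonneg (ν a b d : ℝ) : 0 ≤ nrm ν a b d := Real.sqrt_nonneg _

lemma nrm_sq {ν : ℝ} (hν : 0 < ν) (a b d : ℝ) : nrm ν a b d ^ 2 = a ^ 2 + b ^ 2 + ν * d ^ 2 :=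
  Real.sq_sqrt (by positivity)

lemma dot_le_nrm {ν N : ℝ} (hν : 0 < ν) (hN : N ^ 2 = ν) (e₁ e₂ e₃ a b d : ℝ) :
    e₁ * a + e₂ * b + e₃ * (N * d) ≤ (1 + (e₁ ^ 2 + e₂ ^ 2 + e₃ ^ 2)) / 2 * nrm ν a b d := by
  set E := e₁ ^ 2 + e₂ ^ 2 + e₃ ^ 2 with hE
  have E0 : 0 ≤ E := by positivity
  have n0 := nrm_nonneg ν a b d
  refine (le_abs_self _).trans (abs_le_of_sq_le_sq ?_ (by positivity))
  rw [mul_pow, nrm_sq hν]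
  have h1 : (e₁ * a + e₂ * b + e₃ * (N * d)) ^ 2 ≤ E * (a ^ 2 + b ^ 2 + ν * d ^ 2) := by
    rw [← hN, hE]
    nlinarith [sq_nonneg (e₁ * b - e₂ * a), sq_nonneg (e₁ * (N * d) - e₃ * a),
      sq_nonneg (e₂ * (N * d) - e₃ * b)]
  have h2 : E ≤ ((1 + E) / 2) ^ 2 := by nlinarith [sq_nonneg (E - 1)]
  exact h1.trans (mul_le_mul_of_nonneg_right h2 (by positivity))

lemma nrm_le_of_dot {ν N R : ℝ} (hν : 0 < ν) (hN : N ^ 2 = ν) (a b d : ℝ) (hR : 0 ≤ R)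
    (h : ∀ e₁ e₂ e₃ : ℝ, e₁ ^ 2 + e₂ ^ 2 + e₃ ^ 2 = 1 → e₁ * a + e₂ * b + e₃ * (N * d) ≤ R) :
    nrm ν a b d ≤ R := by
  rcases (nrm_nonneg ν a b d).eq_or_lt with h0 | h0
  · rw [← h0]; exact hR
  · set s := nrm ν a b d with hs
    have hs2 : s ^ 2 = a ^ 2 + b ^ 2 + (N * d) ^ 2 := by rw [nrm_sq hν, ← hN]; ring
    have key := h (a / s) (b / s) (N * d / s) (by
      field_simp; linarith)
    have : a / s * a + b / s * b + N * d / s * (N * d) = s := by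
      field_simp; linarith
    linarith

lemma abs_nrm_sub_le {ν N : ℝ} (hν : 0 < ν) (hN : N ^ 2 = ν) (hN0 : 0 ≤ N)
    (a b d a' b' d' : ℝ) :
    |nrm ν a b d - nrm ν a' b' d'| ≤ |a - a'| + |b - b'| + N * |d - d'| := by
  have main : ∀ a b d a' b' d' : ℝ,
      nrm ν a b d ≤ nrm ν a' b' d' + (|a - a'| + |b - b'| + N * |d - d'|) := by
    intro a b d a' b' d'
    have := nrm_nonneg ν a' b' d'
    refine nrm_le_of_dot hν hN _ _ _ (by positivity) fun e₁ e₂ e₃ he => ?_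
    have h1 := dot_le_nrm hν hN e₁ e₂ e₃ a' b' d'
    rw [he] at h1
    have b1 : |e₁| ≤ 1 := abs_le_one_iff_mul_self_le_one.mpr (by nlinarith)
    have b2 : |e₂| ≤ 1 := abs_le_one_iff_mul_self_le_one.mpr (by nlinarith)
    have b3 : |e₃| ≤ 1 := abs_le_one_iff_mul_self_le_one.mpr (by nlinarith)
    have k1 : e₁ * (a - a') ≤ |a - a'| := (le_abs_self _).trans (by
      rw [abs_mul]; exact mul_le_of_le_one_left (abs_nonneg _) b1)
    have k2 : e₂ * (b - b') ≤ |b - b'| := (le_abs_self _).trans (by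
      rw [abs_mul]; exact mul_le_of_le_one_left (abs_nonneg _) b2)
    have k3 : e₃ * (d - d') ≤ |d - d'| := (le_abs_self _).trans (by
      rw [abs_mul]; exact mul_le_of_le_one_left (abs_nonneg _) b3)
    nlinarith [mul_le_mul_of_nonneg_left k3 hN0]
  rw [abs_le]
  have h1 := main a b d a' b' d'
  have h2 := main a' b' d' a b d
  rw [abs_sub_comm a' a, abs_sub_comm b' b, abs_sub_comm d' d] at h2
  constructor <;> linarith

lemma measurable_nrm {α : Type*} [MeasurableSpace α] {ν : ℝ} {a b d : α → ℝ} (ha : Measurable a)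
    (hb : Measurable b) (hd : Measurable d) : Measurable fun x => nrm ν (a x) (b x) (d x) := by
  unfold nrm; fun_prop

lemma nrm_le {ν N K : ℝ} (hν : 0 < ν) (hN : N ^ 2 = ν) (hN0 : 0 ≤ N) {a b d : ℝ}
    (ha : |a| ≤ K) (hb : |b| ≤ K) (hd : |d| ≤ K) : nrm ν a b d ≤ K * (2 + N) := by
  have h := abs_nrm_sub_le hν hN hN0 a b d 0 0 0
  have h0 : nrm ν 0 0 0 = 0 := by simp [nrm]
  rw [h0, sub_zero, sub_zero, sub_zero, sub_zero, abs_of_nonneg (nrm_nonneg _ _ _ _)] at h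
  nlinarith [mul_le_mul_of_nonneg_left hd hN0]

lemma rotated_dot_le {ν N κ c : ℝ} (hν : 0 < ν) (hN : N ^ 2 = ν) (hκ : κ * N = 1)
    {e₁ e₂ e₃ : ℝ} (he : e₁ ^ 2 + e₂ ^ 2 + e₃ ^ 2 = 1) (x y u₁ u₂ u₃ : ℝ) :
    e₁ * (u₁ + c * (y * u₃)) + e₂ * (u₂ - c * (x * u₃)) + e₃ * (N * u₃) ≤
      (1 + (c * κ) ^ 2 / 2 + (c * κ) ^ 4 / 2) * nrm ν u₁ u₂ u₃
      + (-((c * κ) ^ 3 * e₃ * (y * e₁ - x * e₂)) + (c * κ) ^ 2 / 2 *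
          (e₃ ^ 2 * (x ^ 2 + y ^ 2 - 2) + e₁ ^ 2 * (y ^ 2 - 1) + e₂ ^ 2 * (x ^ 2 - 1)
            - 2 * (e₁ * e₂) * (x * y))) * nrm ν u₁ u₂ u₃
      - e₃ * κ * c * (x * u₂ - y * u₁ - c * u₃) := by
  have h := dot_le_nrm hν hN (e₁ - κ * c * y * e₃) (e₂ + κ * c * x * e₃)
    (e₃ * (1 - (c * κ) ^ 2) + κ * c * (y * e₁ - x * e₂)) u₁ u₂ u₃
  have n0 := nrm_nonneg ν u₁ u₂ u₃
  set R := nrm ν u₁ u₂ u₃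
  have e3 : e₃ ^ 2 = 1 - e₁ ^ 2 - e₂ ^ 2 := by linarith
  have lhs : (e₁ - κ * c * y * e₃) * u₁ + (e₂ + κ * c * x * e₃) * u₂
      + (e₃ * (1 - (c * κ) ^ 2) + κ * c * (y * e₁ - x * e₂)) * (N * u₃)
      = e₁ * (u₁ + c * (y * u₃)) + e₂ * (u₂ - c * (x * u₃)) + e₃ * (N * u₃)
        + e₃ * κ * c * (x * u₂ - y * u₁ - c * u₃) := by
    linear_combination (-(e₃ * c ^ 2 * κ * u₃) + c * (y * e₁ - x * e₂) * u₃) * hκ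
  have rhs : (1 + ((e₁ - κ * c * y * e₃) ^ 2 + (e₂ + κ * c * x * e₃) ^ 2
      + (e₃ * (1 - (c * κ) ^ 2) + κ * c * (y * e₁ - x * e₂)) ^ 2)) / 2
      = 1 + (c * κ) ^ 2 / 2 * (e₁ ^ 2 + e₂ ^ 2) + (c * κ) ^ 4 / 2 * e₃ ^ 2
      + (-((c * κ) ^ 3 * e₃ * (y * e₁ - x * e₂)) + (c * κ) ^ 2 / 2 *
          (e₃ ^ 2 * (x ^ 2 + y ^ 2 - 2) + e₁ ^ 2 * (y ^ 2 - 1) + e₂ ^ 2 * (x ^ 2 - 1)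
            - 2 * (e₁ * e₂) * (x * y))) := by
    linear_combination (1 / 2) * he
  rw [lhs, rhs] at h
  have b1 : (c * κ) ^ 2 / 2 * (e₁ ^ 2 + e₂ ^ 2) ≤ (c * κ) ^ 2 / 2 :=
    mul_le_of_le_one_right (by positivity) (by nlinarith)
  have b2 : (c * κ) ^ 4 / 2 * e₃ ^ 2 ≤ (c * κ) ^ 4 / 2 :=
    mul_le_of_le_one_right (by positivity) (by nlinarith)
  nlinarith [mul_le_mul_of_nonneg_right b1 n0, mul_le_mul_of_nonneg_right b2 n0]

lemma abs_centered_weight_le {κ c : ℝ} (hκ : 0 ≤ κ) (hc : 0 ≤ c) (hc1 : c ≤ 1)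
    {e₁ e₂ e₃ : ℝ} (he : e₁ ^ 2 + e₂ ^ 2 + e₃ ^ 2 = 1) (w : ℝ × ℝ) :
    |-((c * κ) ^ 3 * e₃ * (w.2 * e₁ - w.1 * e₂)) + (c * κ) ^ 2 / 2 *
          (e₃ ^ 2 * (w.1 ^ 2 + w.2 ^ 2 - 2) + e₁ ^ 2 * (w.2 ^ 2 - 1) + e₂ ^ 2 * (w.1 ^ 2 - 1)
            - 2 * (e₁ * e₂) * (w.1 * w.2))| ≤ (κ ^ 3 + 3 * κ ^ 2) * c ^ 2 * rad w ^ 2 := by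
  have r1 := one_le_rad w
  have rr : rad w ^ 2 = 1 + w.1 ^ 2 + w.2 ^ 2 + 2 * |w.1| + 2 * |w.2| + 2 * |w.1 * w.2| := by
    unfold rad; rw [abs_mul]; nlinarith [sq_abs w.1, sq_abs w.2]
  have x0 := abs_nonneg w.1
  have y0 := abs_nonneg w.2
  have xy0 := abs_nonneg (w.1 * w.2)
  have s1 := sq_nonneg e₁
  have s2 := sq_nonneg e₂
  have s3 := sq_nonneg e₃
  have p1 : |e₃ * (w.2 * e₁ - w.1 * e₂)| ≤ rad w ^ 2 := by
    have : |e₃ * (w.2 * e₁ - w.1 * e₂)| ^ 2 ≤ (rad w ^ 2) ^ 2 := by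
      rw [sq_abs]
      have h1 : (w.2 * e₁ - w.1 * e₂) ^ 2 ≤ w.1 ^ 2 + w.2 ^ 2 := by
        nlinarith [sq_nonneg (w.2 * e₂ + w.1 * e₁), mul_nonneg s3 (sq_nonneg w.1),
          mul_nonneg s3 (sq_nonneg w.2)]
      have h2 : (e₃ * (w.2 * e₁ - w.1 * e₂)) ^ 2 ≤ w.1 ^ 2 + w.2 ^ 2 := by
        rw [mul_pow]; nlinarith [sq_nonneg (w.2 * e₁ - w.1 * e₂)]
      nlinarith
    exact abs_le_of_sq_le_sq' this (by positivity) |>.2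
  have p2 : |e₃ ^ 2 * (w.1 ^ 2 + w.2 ^ 2 - 2) + e₁ ^ 2 * (w.2 ^ 2 - 1) + e₂ ^ 2 * (w.1 ^ 2 - 1)
            - 2 * (e₁ * e₂) * (w.1 * w.2)| ≤ 6 * rad w ^ 2 := by
    have q1 : |e₃ ^ 2 * (w.1 ^ 2 + w.2 ^ 2 - 2)| ≤ 2 * rad w ^ 2 := by
      rw [abs_le]; constructor <;> nlinarith [sq_nonneg w.1, sq_nonneg w.2,
        mul_nonneg s3 (sq_nonneg w.1), mul_nonneg s3 (sq_nonneg w.2)]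
    have q2 : |e₁ ^ 2 * (w.2 ^ 2 - 1)| ≤ rad w ^ 2 := by
      rw [abs_le]; constructor <;> nlinarith [sq_nonneg w.1, sq_nonneg w.2,
        mul_nonneg s1 (sq_nonneg w.2)]
    have q3 : |e₂ ^ 2 * (w.1 ^ 2 - 1)| ≤ rad w ^ 2 := by
      rw [abs_le]; constructor <;> nlinarith [sq_nonneg w.1, sq_nonneg w.2,
        mul_nonneg s2 (sq_nonneg w.1)]
    have q4 : |2 * (e₁ * e₂) * (w.1 * w.2)| ≤ 2 * rad w ^ 2 := by
      have : |2 * (e₁ * e₂)| ≤ 1 := by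
        rw [abs_le]; constructor <;> nlinarith [sq_nonneg (e₁ + e₂), sq_nonneg (e₁ - e₂)]
      rw [abs_mul]
      nlinarith [sq_nonneg w.1, sq_nonneg w.2]
    have t1 := abs_sub (e₃ ^ 2 * (w.1 ^ 2 + w.2 ^ 2 - 2) + e₁ ^ 2 * (w.2 ^ 2 - 1)
      + e₂ ^ 2 * (w.1 ^ 2 - 1)) (2 * (e₁ * e₂) * (w.1 * w.2))
    have t2 := abs_add_three (e₃ ^ 2 * (w.1 ^ 2 + w.2 ^ 2 - 2)) (e₁ ^ 2 * (w.2 ^ 2 - 1))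
      (e₂ ^ 2 * (w.1 ^ 2 - 1))
    linarith
  have c3 : (c * κ) ^ 3 ≤ κ ^ 3 * c ^ 2 := by
    have : c ^ 3 ≤ c ^ 2 := pow_le_pow_of_le_one hc hc1 (by norm_num)
    rw [mul_pow]; nlinarith [pow_nonneg hκ 3]
  refine (abs_add_le _ _).trans ?_
  rw [abs_neg, mul_assoc ((c * κ) ^ 3), abs_mul, abs_mul ((c * κ) ^ 2 / 2),
    abs_of_nonneg (by positivity : 0 ≤ (c * κ) ^ 3),
    abs_of_nonneg (by positivity : 0 ≤ (c * κ) ^ 2 / 2)]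
  calc _ ≤ κ ^ 3 * c ^ 2 * rad w ^ 2 + (c * κ) ^ 2 / 2 * (6 * rad w ^ 2) :=
        add_le_add (mul_le_mul c3 p1 (abs_nonneg _) (by positivity))
          (mul_le_mul_of_nonneg_left p2 (by positivity))
    _ = _ := by ring

set_option maxHeartbeats 1000000 in
/-- One step of the discrete gradient estimate. -/
lemma exists_nrm_integral_step_le {ν : ℝ} (hν : 0 < ν) {K : ℝ} (hK : 0 ≤ K) :
    ∃ C, 0 ≤ C ∧ ∀ (c : ℝ) (u₁ u₂ u₃ : ℝ × ℝ → ℝ) (v₁ v₂ v₃ a₁ b₁ a₂ b₂ : ℝ), 0 ≤ c → c ≤ 1 →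
      Measurable u₁ → Measurable u₂ → Measurable u₃ →
      (∀ w, |u₁ w| ≤ K) → (∀ w, |u₂ w| ≤ K) → (∀ w, |u₃ w| ≤ K) →
      (∀ w, |u₁ w - v₁ - c * (a₁ * w.1 + b₁ * w.2)| ≤ K * c ^ 2 * rad w ^ 2) →
      (∀ w, |u₂ w - v₂ - c * (a₂ * w.1 + b₂ * w.2)| ≤ K * c ^ 2 * rad w ^ 2) →
      (∀ w, |u₁ w - v₁| ≤ K * c * rad w) → (∀ w, |u₂ w - v₂| ≤ K * c * rad w) →
      (∀ w, |u₃ w - v₃| ≤ K * c * rad w) → a₂ - b₁ = v₃ →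
      nrm ν (∫ w, (u₁ w + c * (w.2 * u₃ w)) ∂planeGauss)
          (∫ w, (u₂ w - c * (w.1 * u₃ w)) ∂planeGauss) (∫ w, u₃ w ∂planeGauss)
        ≤ (1 + c ^ 2 / ν / 2) * ∫ w, nrm ν (u₁ w) (u₂ w) (u₃ w) ∂planeGauss + C * c ^ 3 := by
  obtain ⟨N, hN0, hN⟩ : ∃ N : ℝ, 0 < N ∧ N ^ 2 = ν :=
    ⟨√ν, Real.sqrt_pos.mpr hν, Real.sq_sqrt hν.le⟩
  set κ := N⁻¹ with hκdef
  have hκ : κ * N = 1 := inv_mul_cancel₀ hN0.ne'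
  have hκ0 : 0 < κ := inv_pos.mpr hN0
  have T0 := radMoment_nonneg
  refine ⟨κ * (3 * K) * radMoment + (κ ^ 3 + 3 * κ ^ 2) * (K * (2 + N)) * radMoment
    + κ ^ 4 * (K * (2 + N)), by positivity, ?_⟩
  intro c u₁ u₂ u₃ v₁ v₂ v₃ a₁ b₁ a₂ b₂ hc hc1 m₁ m₂ m₃ k₁ k₂ k₃ t₁ t₂ l₁ l₂ l₃ hab
  set ρ : ℝ × ℝ → ℝ := fun w => nrm ν (u₁ w) (u₂ w) (u₃ w) with hρdef
  have ρ0 : ∀ w, 0 ≤ ρ w := fun w => nrm_nonneg _ _ _ _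
  have mρ : Measurable ρ := measurable_nrm m₁ m₂ m₃
  have ρK : ∀ w, ρ w ≤ K * (2 + N) := fun w => nrm_le hν hN hN0.le (k₁ w) (k₂ w) (k₃ w)
  have iρ : Integrable ρ planeGauss :=
    integrable_of_bounded mρ _ fun w => by rw [abs_of_nonneg (ρ0 w)]; exact ρK w
  have Rle : ∫ w, ρ w ∂planeGauss ≤ K * (2 + N) := by
    have := integral_mono iρ (integrable_const (K * (2 + N))) ρK
    simpa using this
  have R0 : 0 ≤ ∫ w, ρ w ∂planeGauss := integral_nonneg ρ0
  have i₁ := integrable_of_bounded m₁ _ k₁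
  have i₂ := integrable_of_bounded m₂ _ k₂
  have i₃ := integrable_of_bounded m₃ _ k₃
  have lin : ∀ (x : ℝ × ℝ → ℝ) (u : ℝ × ℝ → ℝ), Measurable x → Measurable u →
      (∀ w, |x w| ≤ rad w) → (∀ w, |u w| ≤ K) → Integrable (fun w => x w * u w) planeGauss := by
    intro x u mx mu hx hu
    refine integrable_of_le_rad (mx.mul mu) K fun w => ?_
    rw [abs_mul, mul_comm]
    have := one_le_rad w
    exact mul_le_mul (hu w) ((hx w).trans (by simpa using rad_pow_le w (k := 1) (by norm_num)))
      (abs_nonneg _) hK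
  have j₁₃ := lin (fun w => w.2) u₃ measurable_snd m₃ abs_snd_le_rad k₃
  have j₂₃ := lin (fun w => w.1) u₃ measurable_fst m₃ abs_fst_le_rad k₃
  obtain ⟨j₂₁, q₁⟩ := abs_integral_linear_mul_sub_le (p := fun w => w.2) (m₁ := 0) (m₂ := 1)
    measurable_snd (fun w => by ring) abs_snd_le_rad m₁ t₁
  obtain ⟨j₁₂, q₂⟩ := abs_integral_linear_mul_sub_le (p := fun w => w.1) (m₁ := 1) (m₂ := 0)
    measurable_fst (fun w => by ring) abs_fst_le_rad m₂ t₂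
  have q₃ : |∫ w, u₃ w ∂planeGauss - v₃| ≤ K * c * radMoment := by
    have : ∫ w, u₃ w ∂planeGauss - v₃ = ∫ w, (u₃ w - v₃) ∂planeGauss := by
      rw [integral_sub i₃ (integrable_const _)]; simp
    rw [this]
    exact abs_integral_le_rad _ fun w => (l₃ w).trans <| mul_le_mul_of_nonneg_left
      (by simpa using rad_pow_le w (k := 1) (by norm_num)) (by positivity)
  refine nrm_le_of_dot hν hN _ _ _ (by positivity) fun e₁ e₂ e₃ he => ?_
  set D : ℝ × ℝ → ℝ := fun w => -((c * κ) ^ 3 * e₃ * (w.2 * e₁ - w.1 * e₂)) + (c * κ) ^ 2 / 2 *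
          (e₃ ^ 2 * (w.1 ^ 2 + w.2 ^ 2 - 2) + e₁ ^ 2 * (w.2 ^ 2 - 1) + e₂ ^ 2 * (w.1 ^ 2 - 1)
            - 2 * (e₁ * e₂) * (w.1 * w.2)) with hD
  have mD : Measurable D := by fun_prop
  have Db : ∀ w, |D w| ≤ (κ ^ 3 + 3 * κ ^ 2) * c ^ 2 * rad w ^ 2 :=
    abs_centered_weight_le hκ0.le hc hc1 he
  obtain ⟨iD, D0⟩ : Integrable D planeGauss ∧ ∫ w, D w ∂planeGauss = 0 := by
    obtain ⟨h1, h2⟩ := integral_quadratic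
      (-((c * κ) ^ 2 / 2 * (2 * e₃ ^ 2 + e₁ ^ 2 + e₂ ^ 2))) ((c * κ) ^ 3 * e₃ * e₂)
      (-((c * κ) ^ 3 * e₃ * e₁)) ((c * κ) ^ 2 / 2 * (e₃ ^ 2 + e₂ ^ 2))
      ((c * κ) ^ 2 / 2 * (e₃ ^ 2 + e₁ ^ 2)) (-((c * κ) ^ 2 / 2 * (2 * (e₁ * e₂))))
    have : D = fun w => (-((c * κ) ^ 2 / 2 * (2 * e₃ ^ 2 + e₁ ^ 2 + e₂ ^ 2)))
      + ((c * κ) ^ 3 * e₃ * e₂) * w.1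
      + (-((c * κ) ^ 3 * e₃ * e₁)) * w.2 + ((c * κ) ^ 2 / 2 * (e₃ ^ 2 + e₂ ^ 2)) * w.1 ^ 2
      + ((c * κ) ^ 2 / 2 * (e₃ ^ 2 + e₁ ^ 2)) * w.2 ^ 2
      + (-((c * κ) ^ 2 / 2 * (2 * (e₁ * e₂)))) * (w.1 * w.2) := by
      ext w; simp only [hD]; ring
    rw [this]
    exact ⟨h1, h2.trans (by ring)⟩
  have ρL : ∀ w, |ρ w - nrm ν v₁ v₂ v₃| ≤ K * (2 + N) * c * rad w := fun w => by
    refine (abs_nrm_sub_le hν hN hN0.le _ _ _ _ _ _).trans ?_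
    nlinarith [l₁ w, l₂ w, mul_le_mul_of_nonneg_left (l₃ w) hN0.le]
  have W := abs_integral_centered_mul_le iD mD mρ D0 (by positivity) Db ρL
  have iDρ : Integrable (fun w => D w * ρ w) planeGauss := by
    refine integrable_of_le_rad (mD.mul mρ)
      ((κ ^ 3 + 3 * κ ^ 2) * c ^ 2 * (K * (2 + N))) fun w => ?_
    rw [abs_mul, abs_of_nonneg (ρ0 w)]
    have := one_le_rad w
    calc _ ≤ ((κ ^ 3 + 3 * κ ^ 2) * c ^ 2 * rad w ^ 2) * (K * (2 + N)) :=
          mul_le_mul (Db w) (ρK w) (ρ0 w) (by positivity)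
      _ = ((κ ^ 3 + 3 * κ ^ 2) * c ^ 2 * (K * (2 + N))) * rad w ^ 2 := by ring
      _ ≤ _ := mul_le_mul_of_nonneg_left (rad_pow_le w (by norm_num)) (by positivity)
  have iL1 := i₁.add (j₁₃.const_mul c)
  have iL2 := i₂.sub (j₂₃.const_mul c)
  have iL := ((iL1.const_mul e₁).add (iL2.const_mul e₂)).add ((i₃.const_mul N).const_mul e₃)
  have iJ := (((j₁₂.sub j₂₁).sub (i₃.const_mul c)).const_mul (e₃ * κ * c))
  have iR := ((iρ.const_mul (1 + (c * κ) ^ 2 / 2 + (c * κ) ^ 4 / 2)).add iDρ).sub iJ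
  have mono := integral_mono iL iR fun w =>
    rotated_dot_le (c := c) hν hN hκ he w.1 w.2 (u₁ w) (u₂ w) (u₃ w)
  have eL := integral_add' ((iL1.const_mul e₁).add (iL2.const_mul e₂))
    ((i₃.const_mul N).const_mul e₃)
  have eL' := integral_add' (iL1.const_mul e₁) (iL2.const_mul e₂)
  have eR := integral_sub' ((iρ.const_mul (1 + (c * κ) ^ 2 / 2 + (c * κ) ^ 4 / 2)).add iDρ) iJ
  have eR' := integral_add' (iρ.const_mul (1 + (c * κ) ^ 2 / 2 + (c * κ) ^ 4 / 2)) iDρ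
  have eJ := integral_sub' (j₁₂.sub j₂₁) (i₃.const_mul c)
  have eJ' := integral_sub' j₁₂ j₂₁
  rw [eL, eL', eR, eR'] at mono
  simp only [integral_const_mul] at mono eJ
  rw [eJ, eJ'] at mono
  simp only [Pi.add_apply, Pi.sub_apply] at mono
  have hJ : |∫ w, w.1 * u₂ w ∂planeGauss - ∫ w, w.2 * u₁ w ∂planeGauss
      - c * ∫ w, u₃ w ∂planeGauss| ≤ 3 * K * c ^ 2 * radMoment := by
    have t : ∫ w, w.1 * u₂ w ∂planeGauss - ∫ w, w.2 * u₁ w ∂planeGauss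
        - c * ∫ w, u₃ w ∂planeGauss
        = (∫ w, w.1 * u₂ w ∂planeGauss - c * (1 * a₂ + 0 * b₂))
          - (∫ w, w.2 * u₁ w ∂planeGauss - c * (0 * a₁ + 1 * b₁))
          - c * (∫ w, u₃ w ∂planeGauss - v₃) := by rw [← hab]; ring
    rw [t]
    refine (abs_sub _ _).trans ?_
    have s₁ := abs_sub (∫ w, w.1 * u₂ w ∂planeGauss - c * (1 * a₂ + 0 * b₂))
      (∫ w, w.2 * u₁ w ∂planeGauss - c * (0 * a₁ + 1 * b₁))
    have s₂ := mul_le_mul_of_nonneg_left q₃ hc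
    rw [abs_mul, abs_of_nonneg hc]
    linarith
  have e3 : |e₃| ≤ 1 := abs_le_one_iff_mul_self_le_one.mpr (by nlinarith)
  have hJ' : -(e₃ * κ * c * (∫ w, w.1 * u₂ w ∂planeGauss - ∫ w, w.2 * u₁ w ∂planeGauss
      - c * ∫ w, u₃ w ∂planeGauss)) ≤ κ * c * (3 * K * c ^ 2 * radMoment) := by
    refine (neg_le_abs _).trans ?_
    rw [mul_assoc e₃, abs_mul, abs_mul e₃, abs_of_nonneg (by positivity : 0 ≤ κ * c)]
    exact mul_le_mul (mul_le_of_le_one_left (by positivity) e3) hJ (abs_nonneg _) (by positivity)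
  have hW := (le_abs_self _).trans W
  have hc4 : (c * κ) ^ 4 / 2 * ∫ w, ρ w ∂planeGauss ≤ κ ^ 4 * (K * (2 + N)) * c ^ 3 := by
    have : (c * κ) ^ 4 / 2 ≤ κ ^ 4 * c ^ 3 := by
      have : c ^ 4 ≤ c ^ 3 := pow_le_pow_of_le_one hc hc1 (by norm_num)
      rw [mul_pow]; nlinarith [pow_nonneg hκ0.le 4, pow_nonneg hc 3, pow_nonneg hc 4]
    calc _ ≤ κ ^ 4 * c ^ 3 * (K * (2 + N)) := mul_le_mul this Rle R0 (by positivity)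
      _ = _ := by ring
  have h_ratio : c ^ 2 / ν / 2 = (c * κ) ^ 2 / 2 := by
    rw [← hN, hκdef]; field_simp
  rw [h_ratio]
  refine mono.trans ?_
  linarith

lemma log_one_add_le_cubic {y : ℝ} (hy : -1 < y) :
    Real.log (1 + y) ≤ y - y ^ 2 / 2 + y ^ 3 / 3 := by
  set h : ℝ → ℝ := fun y => y - y ^ 2 / 2 + y ^ 3 / 3 - Real.log (1 + y) with hh
  have hd : ∀ x : ℝ, -1 < x → HasDerivAt h (x ^ 3 / (1 + x)) x := by
    intro x hx
    have hx' : 1 + x ≠ 0 := by linarith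
    have h1 := (((hasDerivAt_id' x).sub (((hasDerivAt_id' x).pow 2).div_const 2)).add
      (((hasDerivAt_id' x).pow 3).div_const 3)).sub
      (((hasDerivAt_id' x).const_add 1).log hx')
    convert! h1 using 1
    field_simp
    ring
  have h0 : h 0 = 0 := by simp [hh]
  suffices 0 ≤ h y by simp only [hh] at this; linarith
  rcases le_total 0 y with hy0 | hy0
  · have mono : MonotoneOn h (Set.Icc 0 y) := by
      refine monotoneOn_of_deriv_nonneg (convex_Icc _ _)
        (fun x hx => (hd x (by linarith [hx.1])).continuousAt.continuousWithinAt)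
        (fun x hx => ?_) (fun x hx => ?_) <;> rw [interior_Icc] at hx
      · exact (hd x (by linarith [hx.1])).differentiableAt.differentiableWithinAt
      · rw [(hd x (by linarith [hx.1])).deriv]
        have := hx.1.le
        positivity
    rw [← h0]
    exact mono ⟨le_rfl, hy0⟩ ⟨hy0, le_rfl⟩ hy0
  · have anti : AntitoneOn h (Set.Icc y 0) := by
      refine antitoneOn_of_deriv_nonpos (convex_Icc _ _)
        (fun x hx => (hd x (by linarith [hx.1])).continuousAt.continuousWithinAt)
        (fun x hx => ?_) (fun x hx => ?_) <;> rw [interior_Icc] at hx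
      · exact (hd x (by linarith [hx.1])).differentiableAt.differentiableWithinAt
      · rw [(hd x (by linarith [hx.1])).deriv]
        refine div_nonpos_of_nonpos_of_nonneg ?_ (by linarith [hx.1])
        nlinarith [sq_nonneg x, hx.2]
    rw [← h0]
    exact anti ⟨le_rfl, hy0⟩ ⟨hy0, le_rfl⟩ hy0

lemma mul_log_le_taylor {ε m t : ℝ} (hε : 0 < ε) (hm : ε ≤ m) (ht : 0 < t) :
    t * Real.log t ≤ m * Real.log m + (Real.log m + 1) * (t - m) + (t - m) ^ 2 / (2 * m)
      + |t - m| ^ 3 / (6 * ε ^ 2) + (t - m) ^ 4 / (3 * ε ^ 3) := by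
  have hm0 : 0 < m := hε.trans_le hm
  set y := (t - m) / m with hy
  have hty : t = m * (1 + y) := by rw [hy]; field_simp; ring
  have hy1 : 0 < 1 + y := by
    rw [hty] at ht; exact (mul_pos_iff_of_pos_left hm0).mp ht
  have hlog : Real.log t = Real.log m + Real.log (1 + y) := by
    rw [hty, Real.log_mul hm0.ne' hy1.ne']
  have h1 := mul_le_mul_of_nonneg_left (log_one_add_le_cubic (y := y) (by linarith)) ht.le
  have h2 : t * (y - y ^ 2 / 2 + y ^ 3 / 3)
      = (t - m) + (t - m) ^ 2 / (2 * m) - (t - m) ^ 3 / (6 * m ^ 2) + (t - m) ^ 4 / (3 * m ^ 3) := by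
    rw [hy]; field_simp; ring
  have h3 : -((t - m) ^ 3 / (6 * m ^ 2)) ≤ |t - m| ^ 3 / (6 * ε ^ 2) := by
    refine (neg_le_abs _).trans ?_
    rw [abs_div, abs_pow, abs_of_nonneg (by positivity : 0 ≤ 6 * m ^ 2)]
    gcongr
  have h4 : (t - m) ^ 4 / (3 * m ^ 3) ≤ (t - m) ^ 4 / (3 * ε ^ 3) := by
    have : 0 ≤ (t - m) ^ 4 := by positivity
    gcongr
  rw [hlog]
  linarith

lemma mul_log_ge_tangent {m t : ℝ} (hm : 0 < m) (ht : 0 < t) :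
    m * Real.log m + (Real.log m + 1) * (t - m) ≤ t * Real.log t := by
  have h := mul_le_mul_of_nonneg_left (Real.log_le_sub_one_of_pos (div_pos hm ht)) ht.le
  rw [Real.log_div hm.ne' ht.ne'] at h
  have : t * (m / t - 1) = m - t := by field_simp
  linarith

lemma abs_mul_log_le {t K : ℝ} (ht : 0 < t) (hK : t ≤ K) : |t * Real.log t| ≤ 1 + K ^ 2 := by
  have h1 := mul_log_ge_tangent one_pos ht
  have h2 := mul_le_mul_of_nonneg_left (Real.log_le_sub_one_of_pos ht) ht.le
  rw [Real.log_one] at h1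
  rw [abs_le]
  constructor <;> nlinarith

/-- One step of the discrete entropy estimate. -/
lemma exists_entropy_step_le {ε : ℝ} (hε : 0 < ε) {K : ℝ} (hK : 0 ≤ K) :
    ∃ C, 0 ≤ C ∧ ∀ (c : ℝ) (g : ℝ × ℝ → ℝ) (g₀ u₁ u₂ : ℝ), 0 ≤ c → c ≤ 1 →
      Measurable g → (∀ w, ε ≤ g w) → (∀ w, g w ≤ K) → ε ≤ g₀ → |u₁| ≤ K → |u₂| ≤ K →
      (∀ w, |g w - g₀ - c * (u₁ * w.1 + u₂ * w.2)| ≤ K * c ^ 2 * rad w ^ 2) →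
      (∀ w, |g w - g₀| ≤ K * c * rad w) →
      ∫ w, g w * Real.log (g w) ∂planeGauss
        - (∫ w, g w ∂planeGauss) * Real.log (∫ w, g w ∂planeGauss)
        ≤ c ^ 2 * (u₁ ^ 2 + u₂ ^ 2) / (2 * g₀) + C * c ^ 3 := by
  have T0 := radMoment_nonneg
  refine ⟨(K ^ 2 / ε + K ^ 3 / (6 * ε ^ 2) + K ^ 4 / (3 * ε ^ 3)) * radMoment, by positivity, ?_⟩
  intro c g g₀ u₁ u₂ hc hc1 mg gε gK hg₀ k₁ k₂ t₁ l₁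
  set B := K ^ 2 / ε + K ^ 3 / (6 * ε ^ 2) + K ^ 4 / (3 * ε ^ 3) with hB
  have g₀0 : 0 < g₀ := hε.trans_le hg₀
  have g0 : ∀ w, 0 < g w := fun w => hε.trans_le (gε w)
  have ig : Integrable g planeGauss :=
    integrable_of_bounded mg K fun w => by rw [abs_of_pos (g0 w)]; exact gK w
  have igl : Integrable (fun w => g w * Real.log (g w)) planeGauss :=
    integrable_of_bounded (mg.mul mg.log) _ fun w => abs_mul_log_le (g0 w) (gK w)
  have pt : ∀ w, g w * Real.log (g w) ≤ (g₀ * Real.log g₀ + (Real.log g₀ + 1) * (g w - g₀))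
      + (0 + 0 * w.1 + 0 * w.2 + c ^ 2 * u₁ ^ 2 / (2 * g₀) * w.1 ^ 2
        + c ^ 2 * u₂ ^ 2 / (2 * g₀) * w.2 ^ 2 + c ^ 2 * (2 * u₁ * u₂) / (2 * g₀) * (w.1 * w.2))
      + B * c ^ 3 * rad w ^ 6 := by
    intro w
    have r1 := one_le_rad w
    set d := g w - g₀ with hd
    set l := c * (u₁ * w.1 + u₂ * w.2) with hl
    have hlb : |l| ≤ K * c * rad w := by
      rw [hl, abs_mul, abs_of_nonneg hc]
      have : |u₁ * w.1 + u₂ * w.2| ≤ K * rad w := by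
        refine (abs_add_le _ _).trans ?_
        rw [abs_mul, abs_mul, rad]
        nlinarith [mul_le_mul_of_nonneg_right k₁ (abs_nonneg w.1),
          mul_le_mul_of_nonneg_right k₂ (abs_nonneg w.2)]
      nlinarith
    have e2 : d ^ 2 ≤ l ^ 2 + 2 * K ^ 2 * c ^ 3 * rad w ^ 3 := by
      have h1 : |(d - l) * (d + l)| ≤ (K * c ^ 2 * rad w ^ 2) * (2 * (K * c * rad w)) := by
        rw [abs_mul]
        refine mul_le_mul (t₁ w) ?_ (abs_nonneg _) (by positivity)
        exact (abs_add_le _ _).trans (by linarith [l₁ w])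
      have := (le_abs_self _).trans h1
      nlinarith
    have f2 : d ^ 2 / (2 * g₀) ≤ l ^ 2 / (2 * g₀) + K ^ 2 / ε * c ^ 3 * rad w ^ 6 := by
      have h1 : d ^ 2 / (2 * g₀) ≤ l ^ 2 / (2 * g₀) + K ^ 2 * c ^ 3 * rad w ^ 3 / g₀ := by
        calc _ ≤ (l ^ 2 + 2 * K ^ 2 * c ^ 3 * rad w ^ 3) / (2 * g₀) := by gcongr
          _ = _ := by field_simp
      have h2 : K ^ 2 * c ^ 3 * rad w ^ 3 / g₀ ≤ K ^ 2 * c ^ 3 * rad w ^ 6 / ε := by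
        have := rad_pow_le w (k := 3) (by norm_num)
        gcongr
      calc _ ≤ _ := h1.trans (add_le_add_right h2 _)
        _ = _ := by ring
    have f3 : |d| ^ 3 / (6 * ε ^ 2) ≤ K ^ 3 / (6 * ε ^ 2) * c ^ 3 * rad w ^ 6 := by
      have h1 : |d| ^ 3 ≤ (K * c * rad w) ^ 3 := pow_le_pow_left₀ (abs_nonneg _) (l₁ w) 3
      have h2 : (K * c * rad w) ^ 3 ≤ K ^ 3 * c ^ 3 * rad w ^ 6 := by
        have := rad_pow_le w (k := 3) (by norm_num)
        rw [mul_pow, mul_pow]; gcongr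
      calc _ ≤ (K ^ 3 * c ^ 3 * rad w ^ 6) / (6 * ε ^ 2) := by
            have := h1.trans h2; gcongr
        _ = _ := by ring
    have f4 : d ^ 4 / (3 * ε ^ 3) ≤ K ^ 4 / (3 * ε ^ 3) * c ^ 3 * rad w ^ 6 := by
      have h1 : |d| ^ 4 ≤ (K * c * rad w) ^ 4 := pow_le_pow_left₀ (abs_nonneg _) (l₁ w) 4
      rw [Even.pow_abs (by decide)] at h1
      have h2 : (K * c * rad w) ^ 4 ≤ K ^ 4 * c ^ 3 * rad w ^ 6 := by
        have := rad_pow_le w (k := 4) (by norm_num)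
        have : c ^ 4 ≤ c ^ 3 := pow_le_pow_of_le_one hc hc1 (by norm_num)
        rw [mul_pow, mul_pow]; gcongr
      calc _ ≤ (K ^ 4 * c ^ 3 * rad w ^ 6) / (3 * ε ^ 3) := by
            have := h1.trans h2; gcongr
        _ = _ := by ring
    have e5 : l ^ 2 / (2 * g₀) = 0 + 0 * w.1 + 0 * w.2 + c ^ 2 * u₁ ^ 2 / (2 * g₀) * w.1 ^ 2
        + c ^ 2 * u₂ ^ 2 / (2 * g₀) * w.2 ^ 2
        + c ^ 2 * (2 * u₁ * u₂) / (2 * g₀) * (w.1 * w.2) := by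
      rw [hl]; ring
    have := mul_log_le_taylor hε hg₀ (g0 w)
    rw [hB]
    linarith
  obtain ⟨qi, qe⟩ := integral_quadratic 0 0 0 (c ^ 2 * u₁ ^ 2 / (2 * g₀))
    (c ^ 2 * u₂ ^ 2 / (2 * g₀)) (c ^ 2 * (2 * u₁ * u₂) / (2 * g₀))
  have is : Integrable (fun w => (Real.log g₀ + 1) * (g w - g₀)) planeGauss :=
    (ig.sub (integrable_const _)).const_mul _
  have ia : Integrable (fun w => g₀ * Real.log g₀ + (Real.log g₀ + 1) * (g w - g₀)) planeGauss :=
    (integrable_const _).add is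
  have ib := integrable_rad_pow.const_mul (B * c ^ 3)
  have mono := integral_mono igl ((ia.add qi).add ib) pt
  rw [integral_add' (ia.add qi) ib, integral_add' ia qi, qe, integral_const_mul,
    integral_add (integrable_const _) is,
    integral_const_mul (Real.log g₀ + 1), integral_sub ig (integrable_const _)] at mono
  have M0 : 0 < ∫ w, g w ∂planeGauss := by
    have := integral_mono (integrable_const ε) ig gε
    simp at this
    linarith
  have tan := mul_log_ge_tangent g₀0 M0
  simp only [integral_const, probReal_univ, one_smul] at mono
  have e6 : c ^ 2 * (u₁ ^ 2 + u₂ ^ 2) / (2 * g₀)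
      = 0 + c ^ 2 * u₁ ^ 2 / (2 * g₀) + c ^ 2 * u₂ ^ 2 / (2 * g₀) := by ring
  rw [e6, show B * radMoment * c ^ 3 = B * c ^ 3 * radMoment by ring]
  unfold radMoment
  linarith

/-- A horizontal increment of size `c` in the direction `w`. -/
def hstep (c : ℝ) (w : ℝ × ℝ) : H := (c * w.1, c * w.2, 0)

lemma continuous_hstep (c : ℝ) : Continuous (hstep c) := by unfold hstep; fun_prop

/-- The law after `j` steps of the Heisenberg random walk with Gaussian increments of size `c`. -/
def walk (c : ℝ) : ℕ → Measure H
  | 0 => Measure.dirac 0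
  | j + 1 => (planeGauss.prod (walk c j)).map fun q => hmul (hstep c q.1) q.2

lemma measurable_hmul_hstep (c : ℝ) :
    Measurable fun q : (ℝ × ℝ) × H => hmul (hstep c q.1) q.2 :=
  (continuous_hmul.comp (((continuous_hstep c).comp continuous_fst).prodMk
    continuous_snd)).measurable

instance (c : ℝ) (j : ℕ) : IsProbabilityMeasure (walk c j) := by
  induction j with
  | zero => unfold walk; infer_instance
  | succ j ih =>
    unfold walk
    exact Measure.isProbabilityMeasure_map (measurable_hmul_hstep c).aemeasurable

lemma integral_walk_succ {c : ℝ} {j : ℕ} {F : H → ℝ} (hF : Measurable F)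
    (hi : Integrable F (walk c (j + 1))) :
    ∫ s, F s ∂(walk c (j + 1)) = ∫ w, ∫ s, F (hmul (hstep c w) s) ∂(walk c j) ∂planeGauss := by
  rw [walk] at hi ⊢
  have := (integrable_map_measure hF.aestronglyMeasurable
    (measurable_hmul_hstep c).aemeasurable).mp hi
  rw [integral_map (measurable_hmul_hstep c).aemeasurable hF.aestronglyMeasurable]
  exact integral_prod _ this

lemma lintegral_exp_gaussian (t : ℝ) :
    ∫⁻ x, ENNReal.ofReal (Real.exp (t * x)) ∂(gaussianReal 0 1)
      = ENNReal.ofReal (Real.exp (t ^ 2 / 2)) := by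
  rw [← ofReal_integral_eq_lintegral_ofReal (integrable_exp_mul_gaussianReal t)
    (Filter.Eventually.of_forall fun _ => (Real.exp_pos _).le)]
  have := congrFun (mgf_fun_id_gaussianReal (μ := 0) (v := 1)) t
  simp only [mgf, zero_mul, NNReal.coe_one, one_mul, zero_add] at this
  rw [this]

lemma lintegral_exp_planeGauss (t u : ℝ) :
    ∫⁻ w, ENNReal.ofReal (Real.exp (t * w.1 + u * w.2)) ∂planeGauss
      = ENNReal.ofReal (Real.exp ((t ^ 2 + u ^ 2) / 2)) := by
  simp only [Real.exp_add, ENNReal.ofReal_mul (Real.exp_pos _).le]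
  rw [planeGauss, lintegral_prod_mul (f := fun x => ENNReal.ofReal (Real.exp (t * x)))
    (g := fun x => ENNReal.ofReal (Real.exp (u * x))) (by fun_prop) (by fun_prop),
    lintegral_exp_gaussian, lintegral_exp_gaussian, ← ENNReal.ofReal_mul (Real.exp_pos _).le,
    ← Real.exp_add]
  ring_nf

lemma lintegral_exp_walk (c t u : ℝ) (j : ℕ) :
    ∫⁻ s, ENNReal.ofReal (Real.exp (t * s.1 + u * s.2.1)) ∂(walk c j)
      = ENNReal.ofReal (Real.exp ((t ^ 2 + u ^ 2) / 2 * (c ^ 2 * j))) := by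
  induction j with
  | zero =>
    rw [walk, lintegral_dirac' _ (by fun_prop)]
    simp
  | succ j ih =>
    rw [walk, lintegral_map (by fun_prop) (measurable_hmul_hstep c)]
    have e : ∀ q : (ℝ × ℝ) × H, ENNReal.ofReal (Real.exp (t * (hmul (hstep c q.1) q.2).1
        + u * (hmul (hstep c q.1) q.2).2.1))
        = ENNReal.ofReal (Real.exp (t * c * q.1.1 + u * c * q.1.2))
          * ENNReal.ofReal (Real.exp (t * q.2.1 + u * q.2.2.1)) := fun q => by
      rw [← ENNReal.ofReal_mul (Real.exp_pos _).le, ← Real.exp_add]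
      simp only [hmul, hstep]
      ring_nf
    simp only [e]
    rw [lintegral_prod_mul
      (f := fun w : ℝ × ℝ => ENNReal.ofReal (Real.exp (t * c * w.1 + u * c * w.2)))
      (g := fun s : H => ENNReal.ofReal (Real.exp (t * s.1 + u * s.2.1)))
      (by fun_prop) (by fun_prop), lintegral_exp_planeGauss, ih,
      ← ENNReal.ofReal_mul (Real.exp_pos _).le, ← Real.exp_add]
    push_cast
    ring_nf

/-- A polynomial weight on the Heisenberg group. -/
def hrad (s : H) : ℝ := 1 + |s.1| + |s.2.1|

lemma one_le_hrad (s : H) : 1 ≤ hrad s := by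
  unfold hrad; linarith [abs_nonneg s.1, abs_nonneg s.2.1]

lemma continuous_hrad : Continuous hrad := by unfold hrad; fun_prop

/-- A bound for the third moment of `hrad` along the random walk. -/
def walkMoment : ℝ := 6 * Real.exp 1 * (4 * Real.exp 2)

lemma walkMoment_nonneg : 0 ≤ walkMoment := by unfold walkMoment; positivity

lemma hrad_pow_le_exp (s : H) : hrad s ^ 3 ≤ 6 * Real.exp 1 *
    (Real.exp (2 * s.1 + 0 * s.2.1) + Real.exp (-2 * s.1 + 0 * s.2.1)
      + Real.exp (0 * s.1 + 2 * s.2.1) + Real.exp (0 * s.1 + -2 * s.2.1)) := by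
  have h1 := Real.pow_div_factorial_le_exp (hrad s) (by linarith [one_le_hrad s]) 3
  rw [div_le_iff₀ (by positivity)] at h1
  have habs : ∀ x : ℝ, Real.exp |x| ^ 2 ≤ Real.exp (2 * x) + Real.exp (-2 * x) := fun x => by
    rw [← Real.exp_nat_mul]
    rcases abs_cases x with ⟨h, _⟩ | ⟨h, _⟩ <;> rw [h] <;> push_cast
    · linarith [Real.exp_pos (-2 * x)]
    · rw [show 2 * -x = -2 * x by ring]; linarith [Real.exp_pos (2 * x)]
  have e : Real.exp (hrad s) = Real.exp 1 * (Real.exp |s.1| * Real.exp |s.2.1|) := by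
    rw [← Real.exp_add, ← Real.exp_add, hrad, add_assoc]
  have h2 : Real.exp |s.1| * Real.exp |s.2.1| ≤ Real.exp (2 * s.1) + Real.exp (-2 * s.1)
      + Real.exp (2 * s.2.1) + Real.exp (-2 * s.2.1) := by
    nlinarith [habs s.1, habs s.2.1, sq_nonneg (Real.exp |s.1| - Real.exp |s.2.1|),
      Real.exp_pos (2 * s.1), Real.exp_pos (-2 * s.1), Real.exp_pos (2 * s.2.1),
      Real.exp_pos (-2 * s.2.1)]
  have h3 := mul_le_mul_of_nonneg_left h2 (Real.exp_pos 1).le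
  rw [e] at h1
  simp only [zero_mul, zero_add, add_zero]
  refine h1.trans ?_
  have h4 : ((Nat.factorial 3 : ℕ) : ℝ) = 6 := by norm_num [Nat.factorial]
  rw [h4]
  linarith

lemma lintegral_hrad_walk_le {c : ℝ} {j : ℕ} (hj : c ^ 2 * j ≤ 1) :
    ∫⁻ s, ENNReal.ofReal (hrad s ^ 3) ∂(walk c j) ≤ ENNReal.ofReal walkMoment := by
  have b : ∀ t u : ℝ, t ^ 2 + u ^ 2 = 4 →
      ∫⁻ s, ENNReal.ofReal (Real.exp (t * s.1 + u * s.2.1)) ∂(walk c j)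
        ≤ ENNReal.ofReal (Real.exp 2) := fun t u h => by
    rw [lintegral_exp_walk, h]
    exact ENNReal.ofReal_le_ofReal (Real.exp_le_exp.mpr (by linarith))
  calc _ ≤ ∫⁻ s, ENNReal.ofReal (6 * Real.exp 1) *
        (ENNReal.ofReal (Real.exp (2 * s.1 + 0 * s.2.1))
          + ENNReal.ofReal (Real.exp (-2 * s.1 + 0 * s.2.1))
          + ENNReal.ofReal (Real.exp (0 * s.1 + 2 * s.2.1))
          + ENNReal.ofReal (Real.exp (0 * s.1 + -2 * s.2.1))) ∂(walk c j) := by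
        refine lintegral_mono fun s => ?_
        refine (ENNReal.ofReal_le_ofReal (hrad_pow_le_exp s)).trans_eq ?_
        rw [ENNReal.ofReal_mul (by positivity), ENNReal.ofReal_add (by positivity) (by positivity),
          ENNReal.ofReal_add (by positivity) (by positivity),
          ENNReal.ofReal_add (by positivity) (by positivity)]
    _ = ENNReal.ofReal (6 * Real.exp 1) *
        (∫⁻ s, ENNReal.ofReal (Real.exp (2 * s.1 + 0 * s.2.1)) ∂(walk c j)
          + ∫⁻ s, ENNReal.ofReal (Real.exp (-2 * s.1 + 0 * s.2.1)) ∂(walk c j)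
          + ∫⁻ s, ENNReal.ofReal (Real.exp (0 * s.1 + 2 * s.2.1)) ∂(walk c j)
          + ∫⁻ s, ENNReal.ofReal (Real.exp (0 * s.1 + -2 * s.2.1)) ∂(walk c j)) := by
        rw [lintegral_const_mul _ (by fun_prop), lintegral_add_left (by fun_prop),
          lintegral_add_left (by fun_prop), lintegral_add_left (by fun_prop)]
    _ ≤ ENNReal.ofReal (6 * Real.exp 1) * (ENNReal.ofReal (Real.exp 2)
        + ENNReal.ofReal (Real.exp 2) + ENNReal.ofReal (Real.exp 2)
        + ENNReal.ofReal (Real.exp 2)) := by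
        gcongr <;> exact b _ _ (by norm_num)
    _ = _ := by
        rw [← ENNReal.ofReal_add (by positivity) (by positivity),
          ← ENNReal.ofReal_add (by positivity) (by positivity),
          ← ENNReal.ofReal_add (by positivity) (by positivity),
          ← ENNReal.ofReal_mul (by positivity), walkMoment]
        ring_nf

lemma integrable_hrad_walk {c : ℝ} {j : ℕ} (hj : c ^ 2 * j ≤ 1) :
    Integrable (fun s => hrad s ^ 3) (walk c j) := by
  refine ⟨(continuous_hrad.pow 3).aestronglyMeasurable, ?_⟩
  rw [hasFiniteIntegral_iff_ofReal (Filter.Eventually.of_forall fun s => by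
    have := one_le_hrad s; positivity)]
  exact (lintegral_hrad_walk_le hj).trans_lt ENNReal.ofReal_lt_top

lemma integral_hrad_walk_le {c : ℝ} {j : ℕ} (hj : c ^ 2 * j ≤ 1) :
    ∫ s, hrad s ^ 3 ∂(walk c j) ≤ walkMoment := by
  have := lintegral_hrad_walk_le hj
  rw [← ofReal_integral_eq_lintegral_ofReal (integrable_hrad_walk hj)
    (Filter.Eventually.of_forall fun s => by have := one_le_hrad s; positivity)] at this
  exact (ENNReal.ofReal_le_ofReal_iff walkMoment_nonneg).mp this

lemma integrable_walk_of_le {c : ℝ} {j : ℕ} (hj : c ^ 2 * j ≤ 1) {F : H → ℝ} (hF : Measurable F)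
    (C : ℝ) (h : ∀ s, |F s| ≤ C * hrad s ^ 3) : Integrable F (walk c j) :=
  ((integrable_hrad_walk hj).const_mul C).mono' hF.aestronglyMeasurable
    (Filter.Eventually.of_forall h)

lemma abs_integral_walk_le {c : ℝ} {j : ℕ} (hj : c ^ 2 * j ≤ 1) {F : H → ℝ}
    {C : ℝ} (hC : 0 ≤ C) (h : ∀ s, |F s| ≤ C * hrad s ^ 3) :
    |∫ s, F s ∂(walk c j)| ≤ C * walkMoment := by
  have := norm_integral_le_of_norm_le (f := F) ((integrable_hrad_walk hj).const_mul C)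
    (Filter.Eventually.of_forall h)
  rw [integral_const_mul] at this
  exact this.trans (mul_le_mul_of_nonneg_left (integral_hrad_walk_le hj) hC)

/-- The endpoint of the horizontal random walk of step size `c` driven by `v`. -/
def walkEnd (c : ℝ) (m : ℕ) (v : Fin m → H) : H :=
  (c * ∑ i, (v i).1, c * ∑ i, (v i).2.1,
    c ^ 2 / 2 * ∑ i : Fin m, ∑ j : Fin m,
      (if i.val < j.val then (v i).1 * (v j).2.1 - (v i).2.1 * (v j).1 else 0))

lemma measurable_walkEnd (c : ℝ) (m : ℕ) : Measurable (walkEnd c m) := by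
  unfold walkEnd
  have h : ∀ i j : Fin m, Measurable fun v : Fin m → H =>
      (if i.val < j.val then (v i).1 * (v j).2.1 - (v i).2.1 * (v j).1 else 0) := fun i j => by
    split_ifs <;> fun_prop
  have h2 : Measurable fun v : Fin m → H => ∑ i : Fin m, ∑ j : Fin m,
      (if i.val < j.val then (v i).1 * (v j).2.1 - (v i).2.1 * (v j).1 else 0) :=
    Finset.measurable_sum _ fun i _ => Finset.measurable_sum _ fun j _ => h i j
  refine Measurable.prodMk (by fun_prop) (Measurable.prodMk (by fun_prop) (h2.const_mul _))

lemma walkEnd_succ (c : ℝ) (m : ℕ) (v : Fin (m + 1) → H) :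
    walkEnd c (m + 1) v
      = hmul (hstep c ((v 0).1, (v 0).2.1)) (walkEnd c m fun i => v i.succ) := by
  simp only [walkEnd, hmul, hstep, Fin.sum_univ_succ, Fin.val_zero, Fin.val_succ,
    if_false, Nat.succ_pos, if_true, Nat.not_lt_zero, add_lt_add_iff_right, zero_add,
    Finset.sum_sub_distrib, ← Finset.mul_sum]
  ext
  · simp; ring
  · simp; ring
  · simp; ring

lemma map_stdGauss3 : stdGauss3.map (fun p => (p.1, p.2.1)) = planeGauss := by
  have h := Measure.map_prod_map (gaussianReal 0 1) ((gaussianReal 0 1).prod (gaussianReal 0 1))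
    measurable_id measurable_fst
  rw [Measure.map_id, Measure.map_fst_prod, measure_univ, one_smul] at h
  rw [planeGauss, h]
  rfl

instance : IsProbabilityMeasure stdGauss3 := by unfold stdGauss3; infer_instance

lemma map_walkEnd (c : ℝ) (m : ℕ) : (gaussN m).map (walkEnd c m) = walk c m := by
  induction m with
  | zero =>
    have : walkEnd c 0 = fun _ => 0 := by ext v <;> simp [walkEnd]
    have : IsProbabilityMeasure (gaussN 0) := by unfold gaussN; infer_instance
    rw [‹walkEnd c 0 = _›, Measure.map_const, measure_univ, one_smul, walk]
  | succ m ih =>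
    have hp := measurePreserving_piFinSuccAbove (fun _ : Fin (m + 1) => stdGauss3) 0
    have e : walkEnd c (m + 1) = (fun q => hmul (hstep c q.1) q.2) ∘
        (Prod.map (fun p : H => (p.1, p.2.1)) (walkEnd c m)) ∘
        (MeasurableEquiv.piFinSuccAbove (fun _ : Fin (m + 1) => H) 0) := by
      ext1 v
      rw [walkEnd_succ]
      rfl
    have mpr : Measurable (Prod.map (fun p : H => (p.1, p.2.1)) (walkEnd c m)) :=
      Measurable.prodMap (by fun_prop) (measurable_walkEnd c m)
    rw [e, ← Measure.map_map (measurable_hmul_hstep c) (mpr.comp (MeasurableEquiv.measurable _)),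
      ← Measure.map_map mpr (MeasurableEquiv.measurable _), gaussN, hp.map_eq,
      ← Measure.map_prod_map _ _ (by fun_prop) (measurable_walkEnd c m), map_stdGauss3]
    rw [walk, ← ih]
    rfl

lemma nuMeas_zero_eq_walk (n : ℕ) : nuMeas 0 n = walk ((n : ℝ) ^ (-(1:ℝ)/2)) n := by
  rw [← map_walkEnd, nuMeas]
  congr 1
  ext1 v
  have hc : ((n : ℝ) ^ (-(1:ℝ)/2)) ^ 2 = (n : ℝ)⁻¹ := by
    rw [← Real.rpow_natCast, ← Real.rpow_mul (Nat.cast_nonneg n)]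
    norm_num [Real.rpow_neg_one]
  simp only [snk, walkEnd, Fin.is_lt, if_true, and_true, zero_mul, zero_add, hc]
  congr 3
  rw [mul_inv, div_eq_mul_inv, mul_comm]

lemma hmul_hstep_hmul (h s : H) (c : ℝ) (w : ℝ × ℝ) :
    hmul (hmul h (hstep c w)) s
      = hmul (hmul h s) (c * w.1, c * w.2, c * w.1 * s.2.1 - c * w.2 * s.1) :=
  hmul_conj h s _ _

lemma abs_increment_le {c : ℝ} (hc : 0 ≤ c) (w : ℝ × ℝ) (s : H) :
    |c * w.1| + |c * w.2| + |c * w.1 * s.2.1 - c * w.2 * s.1| ≤ c * (rad w * hrad s) := by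
  have h := abs_sub (c * w.1 * s.2.1) (c * w.2 * s.1)
  simp only [abs_mul, abs_of_nonneg hc] at h ⊢
  have : c * |w.1| + c * |w.2| + (c * |w.1| * |s.2.1| + c * |w.2| * |s.1|)
      ≤ c * (rad w * hrad s) := by
    rw [rad, hrad]
    have p1 := mul_nonneg hc (abs_nonneg w.1)
    have p2 := mul_nonneg hc (abs_nonneg w.2)
    nlinarith [mul_nonneg p1 (abs_nonneg s.1), mul_nonneg p2 (abs_nonneg s.2.1),
      mul_nonneg hc (abs_nonneg s.1), mul_nonneg hc (abs_nonneg s.2.1)]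
  linarith

/-- The weighted average of `g` along the random walk started at `h`. -/
def avg (c : ℝ) (j : ℕ) (q g : H → ℝ) (h : H) : ℝ := ∫ s, q s * g (hmul h s) ∂(walk c j)

lemma measurable_hmul_left (h : H) : Measurable (hmul h) :=
  (continuous_hmul.comp (Continuous.prodMk continuous_const continuous_id)).measurable

lemma measurable_avg (c : ℝ) (j : ℕ) {q g : H → ℝ} (hq : Measurable q) (hg : Measurable g) :
    Measurable (avg c j q g) := by
  have : StronglyMeasurable (Function.uncurry fun h s : H => q s * g (hmul h s)) :=
    ((hq.comp measurable_snd).mul (hg.comp continuous_hmul.measurable)).stronglyMeasurable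
  exact (this.integral_prod_right (ν := walk c j)).measurable

lemma hrad_pow_le {k : ℕ} (hk : k ≤ 3) (s : H) : hrad s ^ k ≤ hrad s ^ 3 :=
  pow_le_pow_right₀ (one_le_hrad s) hk

lemma integrable_avg {c : ℝ} {j : ℕ} (hj : c ^ 2 * j ≤ 1) {q g : H → ℝ} (hq : Measurable q)
    (hg : Measurable g) (hqb : ∀ s, |q s| ≤ hrad s ^ 3) {K : ℝ} (hK : ∀ p, |g p| ≤ K) (h : H) :
    Integrable (fun s => q s * g (hmul h s)) (walk c j) := by
  refine integrable_walk_of_le hj (hq.mul (hg.comp (measurable_hmul_left h))) K fun s => ?_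
  rw [abs_mul, mul_comm K]
  have := one_le_hrad s
  exact mul_le_mul (hqb s) (hK _) (abs_nonneg _) (by positivity)

lemma exists_avg_jet (g : 𝓢(H, ℝ)) : ∃ K, 0 ≤ K ∧ ∀ (c : ℝ) (j : ℕ) (q : H → ℝ) (h : H), 0 ≤ c →
    c ^ 2 * j ≤ 1 → Measurable q → (∀ s, |q s| ≤ hrad s) →
    |avg c j q g h| ≤ K ∧ ∀ w : ℝ × ℝ,
      |avg c j q g (hmul h (hstep c w)) - avg c j q g h| ≤ K * c * rad w ∧
      |avg c j q g (hmul h (hstep c w)) - avg c j q g h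
        - c * ((avg c j q (schwartzX g) h + avg c j (fun s => q s * s.2.1) (schwartzZ g) h) * w.1
          + (avg c j q (schwartzY g) h - avg c j (fun s => q s * s.1) (schwartzZ g) h) * w.2)|
        ≤ K * c ^ 2 * rad w ^ 2 := by
  obtain ⟨K₀, k₀, hK₀⟩ := schwartz_bounded g
  obtain ⟨K₁, k₁, hK₁⟩ := schwartz_lipschitz g
  obtain ⟨K₂, k₂, hK₂⟩ := schwartz_taylor g
  obtain ⟨KX, kX, hKX⟩ := schwartz_bounded (schwartzX g)
  obtain ⟨KY, kY, hKY⟩ := schwartz_bounded (schwartzY g)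
  obtain ⟨KZ, kZ, hKZ⟩ := schwartz_bounded (schwartzZ g)
  have M0 := walkMoment_nonneg
  have le₀ : K₀ * walkMoment ≤ (K₀ + K₁ + K₂) * walkMoment :=
    mul_le_mul_of_nonneg_right (by linarith) M0
  have le₁ : K₁ * walkMoment ≤ (K₀ + K₁ + K₂) * walkMoment :=
    mul_le_mul_of_nonneg_right (by linarith) M0
  have le₂ : K₂ * walkMoment ≤ (K₀ + K₁ + K₂) * walkMoment :=
    mul_le_mul_of_nonneg_right (by linarith) M0
  refine ⟨(K₀ + K₁ + K₂) * walkMoment, by positivity, fun c j q h hc hj mq hq => ?_⟩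
  have hq3 : ∀ s, |q s| ≤ hrad s ^ 3 := fun s =>
    (hq s).trans (by simpa using hrad_pow_le (k := 1) (by norm_num) s)
  have hqa : ∀ s, |q s * s.1| ≤ hrad s ^ 3 := fun s => by
    have := one_le_hrad s
    have h1 : |s.1| ≤ hrad s := by unfold hrad; linarith [abs_nonneg s.1, abs_nonneg s.2.1]
    rw [abs_mul]
    calc _ ≤ hrad s * hrad s := mul_le_mul (hq s) h1 (abs_nonneg _) (by linarith)
      _ = hrad s ^ 2 := by ring
      _ ≤ _ := hrad_pow_le (by norm_num) s
  have hqb : ∀ s, |q s * s.2.1| ≤ hrad s ^ 3 := fun s => by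
    have := one_le_hrad s
    have h1 : |s.2.1| ≤ hrad s := by unfold hrad; linarith [abs_nonneg s.1, abs_nonneg s.2.1]
    rw [abs_mul]
    calc _ ≤ hrad s * hrad s := mul_le_mul (hq s) h1 (abs_nonneg _) (by linarith)
      _ = hrad s ^ 2 := by ring
      _ ≤ _ := hrad_pow_le (by norm_num) s
  have mg : ∀ f : 𝓢(H, ℝ), Measurable f := fun f => f.continuous.measurable
  refine ⟨le_trans (abs_integral_walk_le hj k₀ fun s => ?_) le₀, fun w => ⟨?_, ?_⟩⟩
  · rw [abs_mul, mul_comm K₀]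
    have := one_le_hrad s
    exact mul_le_mul (hq3 s) (hK₀ _) (abs_nonneg _) (by positivity)
  all_goals
    have r1 := one_le_rad w
    have i₀ := integrable_avg hj mq (mg g) hq3 hK₀ h
    have i₁ := integrable_avg hj mq (mg g) hq3 hK₀ (hmul h (hstep c w))
  · rw [avg, avg, ← integral_sub i₁ i₀]
    refine (abs_integral_walk_le hj (C := K₁ * (c * rad w)) (by positivity) fun s => ?_).trans ?_
    · have s1 := one_le_hrad s
      rw [← mul_sub, abs_mul, hmul_hstep_hmul]
      have hl := (hK₁ (hmul h s) (c * w.1, c * w.2, c * w.1 * s.2.1 - c * w.2 * s.1)).trans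
        (mul_le_mul_of_nonneg_left (abs_increment_le hc w s) k₁)
      calc _ ≤ hrad s * (K₁ * (c * (rad w * hrad s))) :=
            mul_le_mul (hq s) hl (abs_nonneg _) (by linarith)
        _ = K₁ * (c * rad w) * hrad s ^ 2 := by ring
        _ ≤ _ := mul_le_mul_of_nonneg_left (hrad_pow_le (by norm_num) s) (by positivity)
    · calc _ = K₁ * walkMoment * (c * rad w) := by ring
        _ ≤ (K₀ + K₁ + K₂) * walkMoment * (c * rad w) :=
            mul_le_mul_of_nonneg_right le₁ (by positivity)
        _ = _ := by ring
  · have iX := integrable_avg hj mq (mg (schwartzX g)) hq3 hKX h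
    have iY := integrable_avg hj mq (mg (schwartzY g)) hq3 hKY h
    have iZb := integrable_avg hj (q := fun s => q s * s.2.1) (by fun_prop) (mg (schwartzZ g))
      hqb hKZ h
    have iZa := integrable_avg hj (q := fun s => q s * s.1) (by fun_prop) (mg (schwartzZ g))
      hqa hKZ h
    have e : avg c j q g (hmul h (hstep c w)) - avg c j q g h
        - c * ((avg c j q (schwartzX g) h + avg c j (fun s => q s * s.2.1) (schwartzZ g) h) * w.1
          + (avg c j q (schwartzY g) h - avg c j (fun s => q s * s.1) (schwartzZ g) h) * w.2)
        = ∫ s, (q s * g (hmul (hmul h (hstep c w)) s) - q s * g (hmul h s)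
          - c * ((q s * schwartzX g (hmul h s) + q s * s.2.1 * schwartzZ g (hmul h s)) * w.1
            + (q s * schwartzY g (hmul h s) - q s * s.1 * schwartzZ g (hmul h s)) * w.2))
          ∂(walk c j) := by
      have p₁ : Integrable (fun s => (q s * schwartzX g (hmul h s)
          + q s * s.2.1 * schwartzZ g (hmul h s)) * w.1) (walk c j) := (iX.add iZb).mul_const _
      have p₂ : Integrable (fun s => (q s * schwartzY g (hmul h s)
          - q s * s.1 * schwartzZ g (hmul h s)) * w.2) (walk c j) := (iY.sub iZa).mul_const _
      have p₃ : Integrable (fun s => c * ((q s * schwartzX g (hmul h s)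
          + q s * s.2.1 * schwartzZ g (hmul h s)) * w.1 + (q s * schwartzY g (hmul h s)
          - q s * s.1 * schwartzZ g (hmul h s)) * w.2)) (walk c j) := (p₁.add p₂).const_mul c
      have p₄ : Integrable (fun s => q s * g (hmul (hmul h (hstep c w)) s)
          - q s * g (hmul h s)) (walk c j) := i₁.sub i₀
      rw [integral_sub p₄ p₃, integral_sub i₁ i₀, integral_const_mul, integral_add p₁ p₂,
        integral_mul_const, integral_mul_const, integral_add iX iZb, integral_sub iY iZa]
      rfl
    rw [e]
    refine (abs_integral_walk_le hj (C := K₂ * (c * rad w) ^ 2) (by positivity) fun s => ?_).trans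
      ?_
    · have s1 := one_le_hrad s
      have hl := hK₂ (hmul h s) (c * w.1, c * w.2, c * w.1 * s.2.1 - c * w.2 * s.1)
      rw [← hmul_hstep_hmul] at hl
      have hl' := hl.trans (mul_le_mul_of_nonneg_left
        (pow_le_pow_left₀ (by positivity) (abs_increment_le hc w s) 2) k₂)
      have e' : q s * g (hmul (hmul h (hstep c w)) s) - q s * g (hmul h s)
          - c * ((q s * schwartzX g (hmul h s) + q s * s.2.1 * schwartzZ g (hmul h s)) * w.1
            + (q s * schwartzY g (hmul h s) - q s * s.1 * schwartzZ g (hmul h s)) * w.2)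
          = q s * (g (hmul (hmul h (hstep c w)) s) - g (hmul h s)
            - (c * w.1 * schwartzX g (hmul h s) + c * w.2 * schwartzY g (hmul h s)
              + (c * w.1 * s.2.1 - c * w.2 * s.1) * schwartzZ g (hmul h s))) := by ring
      rw [e', abs_mul]
      calc _ ≤ hrad s * (K₂ * (c * (rad w * hrad s)) ^ 2) :=
            mul_le_mul (hq s) hl' (abs_nonneg _) (by linarith)
        _ = _ := by ring
    · calc _ = K₂ * walkMoment * (c * rad w) ^ 2 := by ring
        _ ≤ (K₀ + K₁ + K₂) * walkMoment * (c * rad w) ^ 2 :=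
            mul_le_mul_of_nonneg_right le₂ (by positivity)
        _ = _ := by ring

/-- The discrete heat semigroup: the average of `g` along the random walk started at `h`. -/
def heat (c : ℝ) (j : ℕ) (g : H → ℝ) (h : H) : ℝ := ∫ s, g (hmul h s) ∂(walk c j)

lemma avg_one (c : ℝ) (j : ℕ) (g : H → ℝ) (h : H) : avg c j (fun _ => 1) g h = heat c j g h := by
  simp [avg, heat]

lemma measurable_heat (c : ℝ) (j : ℕ) {g : H → ℝ} (hg : Measurable g) :
    Measurable (heat c j g) := by
  have := measurable_avg c j (q := fun _ => 1) measurable_const hg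
  rwa [funext (avg_one c j g)] at this

/-- The component along `X` of the gradient of `heat c j g`. -/
def heatX (c : ℝ) (j : ℕ) (g : 𝓢(H, ℝ)) (h : H) : ℝ :=
  heat c j (schwartzX g) h + avg c j (fun s => s.2.1) (schwartzZ g) h

/-- The component along `Y` of the gradient of `heat c j g`. -/
def heatY (c : ℝ) (j : ℕ) (g : 𝓢(H, ℝ)) (h : H) : ℝ :=
  heat c j (schwartzY g) h - avg c j (fun s => s.1) (schwartzZ g) h

/-- The component along `Z` of the gradient of `heat c j g`. -/
def heatZ (c : ℝ) (j : ℕ) (g : 𝓢(H, ℝ)) (h : H) : ℝ := heat c j (schwartzZ g) h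

lemma measurable_schwartz (g : 𝓢(H, ℝ)) : Measurable g := g.continuous.measurable

lemma measurable_heatX (c : ℝ) (j : ℕ) (g : 𝓢(H, ℝ)) : Measurable (heatX c j g) :=
  (measurable_heat c j (measurable_schwartz _)).add
    (measurable_avg c j (by fun_prop) (measurable_schwartz _))

lemma measurable_heatY (c : ℝ) (j : ℕ) (g : 𝓢(H, ℝ)) : Measurable (heatY c j g) :=
  (measurable_heat c j (measurable_schwartz _)).sub
    (measurable_avg c j (by fun_prop) (measurable_schwartz _))

lemma measurable_heatZ (c : ℝ) (j : ℕ) (g : 𝓢(H, ℝ)) : Measurable (heatZ c j g) :=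
  measurable_heat c j (measurable_schwartz _)

lemma abs_fst_le_hrad (s : H) : |s.1| ≤ hrad s := by
  unfold hrad; linarith [abs_nonneg s.1, abs_nonneg s.2.1]

lemma abs_snd_le_hrad (s : H) : |s.2.1| ≤ hrad s := by
  unfold hrad; linarith [abs_nonneg s.1, abs_nonneg s.2.1]

lemma hrad_le_pow (s : H) : hrad s ≤ hrad s ^ 3 := by
  simpa using hrad_pow_le (k := 1) (by norm_num) s

lemma integrable_heat (c : ℝ) (j : ℕ) {g : H → ℝ} (hg : Measurable g) {K : ℝ}
    (hK : ∀ p, |g p| ≤ K) (h : H) : Integrable (fun s => g (hmul h s)) (walk c j) :=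
  Integrable.of_bound (hg.comp (measurable_hmul_left h)).aestronglyMeasurable K
    (Filter.Eventually.of_forall fun _ => hK _)

lemma abs_heat_le (c : ℝ) (j : ℕ) {g : H → ℝ} {K : ℝ} (hK : ∀ p, |g p| ≤ K) (h : H) :
    |heat c j g h| ≤ K := by
  have := norm_integral_le_of_norm_le_const (μ := walk c j) (f := fun s => g (hmul h s))
    (Filter.Eventually.of_forall fun _ => hK _)
  simpa [heat] using this

lemma heat_zero (c : ℝ) (g : H → ℝ) (h : H) : heat c 0 g h = g h := by
  rw [heat, walk, integral_dirac, hmul_zero]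

lemma heat_succ (c : ℝ) (j : ℕ) {g : H → ℝ} (hg : Measurable g) {K : ℝ} (hK : ∀ p, |g p| ≤ K)
    (h : H) : heat c (j + 1) g h = ∫ w, heat c j g (hmul h (hstep c w)) ∂planeGauss := by
  rw [heat, integral_walk_succ (F := fun s => g (hmul h s)) (hg.comp (measurable_hmul_left h))
    (integrable_heat _ _ hg hK h)]
  simp only [heat, hmul_assoc]

lemma heatX_zero (c : ℝ) (g : 𝓢(H, ℝ)) (h : H) : heatX c 0 g h = schwartzX g h := by
  simp [heatX, heat_zero, avg, walk]

lemma heatY_zero (c : ℝ) (g : 𝓢(H, ℝ)) (h : H) : heatY c 0 g h = schwartzY g h := by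
  simp [heatY, heat_zero, avg, walk]

lemma heatZ_zero (c : ℝ) (g : 𝓢(H, ℝ)) (h : H) : heatZ c 0 g h = schwartzZ g h :=
  heat_zero _ _ _

lemma le_one_of_succ {c : ℝ} {j : ℕ} (hj : c ^ 2 * ((j + 1 : ℕ) : ℝ) ≤ 1) : c ^ 2 * j ≤ 1 := by
  push_cast at hj
  nlinarith [sq_nonneg c]

lemma heatZ_succ (c : ℝ) (j : ℕ) (g : 𝓢(H, ℝ)) (h : H) :
    heatZ c (j + 1) g h = ∫ w, heatZ c j g (hmul h (hstep c w)) ∂planeGauss := by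
  obtain ⟨K, -, hK⟩ := schwartz_bounded (schwartzZ g)
  exact heat_succ c j (measurable_schwartz _) hK h

lemma integrable_avg_schwartz {c : ℝ} {j : ℕ} (hj : c ^ 2 * j ≤ 1) {q : H → ℝ}
    (hq : Measurable q) (hqb : ∀ s, |q s| ≤ hrad s) (g : 𝓢(H, ℝ)) (h : H) :
    Integrable (fun s => q s * g (hmul h s)) (walk c j) := by
  obtain ⟨K, -, hK⟩ := schwartz_bounded g
  exact integrable_avg hj hq (measurable_schwartz _) (fun s => (hqb s).trans (hrad_le_pow s)) hK h

lemma integrable_heat_schwartz (c : ℝ) (j : ℕ) (g : 𝓢(H, ℝ)) (h : H) :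
    Integrable (fun s => g (hmul h s)) (walk c j) := by
  obtain ⟨K, -, hK⟩ := schwartz_bounded g
  exact integrable_heat c j (measurable_schwartz _) hK h

lemma heatX_succ {c : ℝ} {j : ℕ} (hj : c ^ 2 * ((j + 1 : ℕ) : ℝ) ≤ 1) (g : 𝓢(H, ℝ)) (h : H) :
    heatX c (j + 1) g h = ∫ w, (heatX c j g (hmul h (hstep c w))
      + c * (w.2 * heatZ c j g (hmul h (hstep c w)))) ∂planeGauss := by
  have hj' := le_one_of_succ hj
  have i₁ := integrable_heat_schwartz c (j + 1) (schwartzX g) h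
  have i₂ := integrable_avg_schwartz hj (q := fun s => s.2.1) (by fun_prop) abs_snd_le_hrad
    (schwartzZ g) h
  have m : Measurable fun s => schwartzX g (hmul h s) + s.2.1 * schwartzZ g (hmul h s) :=
    ((measurable_schwartz _).comp (measurable_hmul_left h)).add
      (Measurable.mul (by fun_prop) ((measurable_schwartz _).comp (measurable_hmul_left h)))
  rw [heatX, heat, avg, ← integral_add i₁ i₂, integral_walk_succ m (i₁.add i₂)]
  refine integral_congr_ae (Filter.Eventually.of_forall fun w => ?_)
  have k₁ := integrable_heat_schwartz c j (schwartzX g) (hmul h (hstep c w))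
  have k₂ := integrable_avg_schwartz hj' (q := fun s => s.2.1) (by fun_prop) abs_snd_le_hrad
    (schwartzZ g) (hmul h (hstep c w))
  have k₃ := (integrable_heat_schwartz c j (schwartzZ g) (hmul h (hstep c w))).const_mul (c * w.2)
  have k₁₂ : Integrable (fun s => schwartzX g (hmul (hmul h (hstep c w)) s)
    + s.2.1 * schwartzZ g (hmul (hmul h (hstep c w)) s)) (walk c j) := k₁.add k₂
  simp only [heatX, heatZ, heat, avg]
  rw [← integral_add k₁ k₂, ← mul_assoc, ← integral_const_mul, ← integral_add k₁₂ k₃]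
  refine integral_congr_ae (Filter.Eventually.of_forall fun s => ?_)
  simp only [hmul_assoc]
  have : (hmul (hstep c w) s).2.1 = c * w.2 + s.2.1 := rfl
  rw [this]
  ring

lemma heatY_succ {c : ℝ} {j : ℕ} (hj : c ^ 2 * ((j + 1 : ℕ) : ℝ) ≤ 1) (g : 𝓢(H, ℝ)) (h : H) :
    heatY c (j + 1) g h = ∫ w, (heatY c j g (hmul h (hstep c w))
      - c * (w.1 * heatZ c j g (hmul h (hstep c w)))) ∂planeGauss := by
  have hj' := le_one_of_succ hj
  have i₁ := integrable_heat_schwartz c (j + 1) (schwartzY g) h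
  have i₂ := integrable_avg_schwartz hj (q := fun s => s.1) (by fun_prop) abs_fst_le_hrad
    (schwartzZ g) h
  have m : Measurable fun s => schwartzY g (hmul h s) - s.1 * schwartzZ g (hmul h s) :=
    ((measurable_schwartz _).comp (measurable_hmul_left h)).sub
      (Measurable.mul (by fun_prop) ((measurable_schwartz _).comp (measurable_hmul_left h)))
  rw [heatY, heat, avg, ← integral_sub i₁ i₂, integral_walk_succ m (i₁.sub i₂)]
  refine integral_congr_ae (Filter.Eventually.of_forall fun w => ?_)
  have k₁ := integrable_heat_schwartz c j (schwartzY g) (hmul h (hstep c w))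
  have k₂ := integrable_avg_schwartz hj' (q := fun s => s.1) (by fun_prop) abs_fst_le_hrad
    (schwartzZ g) (hmul h (hstep c w))
  have k₃ := (integrable_heat_schwartz c j (schwartzZ g) (hmul h (hstep c w))).const_mul (c * w.1)
  have k₁₂ : Integrable (fun s => schwartzY g (hmul (hmul h (hstep c w)) s)
    - s.1 * schwartzZ g (hmul (hmul h (hstep c w)) s)) (walk c j) := k₁.sub k₂
  simp only [heatY, heatZ, heat, avg]
  rw [← integral_sub k₁ k₂, ← mul_assoc, ← integral_const_mul, ← integral_sub k₁₂ k₃]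
  refine integral_congr_ae (Filter.Eventually.of_forall fun s => ?_)
  simp only [hmul_assoc]
  have : (hmul (hstep c w) s).1 = c * w.1 + s.1 := rfl
  rw [this]
  ring

lemma heat_bracket (c : ℝ) (j : ℕ) (g : 𝓢(H, ℝ)) (h : H) :
    heat c j (schwartzX (schwartzY g)) h - heat c j (schwartzY (schwartzX g)) h
      = heatZ c j g h := by
  rw [heatZ, heat, heat, ← integral_sub (integrable_heat_schwartz c j _ h)
    (integrable_heat_schwartz c j _ h), heat]
  refine integral_congr_ae (Filter.Eventually.of_forall fun s => ?_)
  simp only [schwartzX_schwartzY]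
  ring

lemma exists_heat_jet (g : 𝓢(H, ℝ)) : ∃ K, 0 ≤ K ∧ ∀ (c : ℝ) (j : ℕ) (h : H), 0 ≤ c →
    c ^ 2 * j ≤ 1 → |heatX c j g h| ≤ K ∧ |heatY c j g h| ≤ K ∧ |heatZ c j g h| ≤ K ∧
      (∀ w, |heat c j g (hmul h (hstep c w)) - heat c j g h| ≤ K * c * rad w) ∧
      (∀ w, |heat c j g (hmul h (hstep c w)) - heat c j g h
        - c * (heatX c j g h * w.1 + heatY c j g h * w.2)| ≤ K * c ^ 2 * rad w ^ 2) ∧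
      (∀ w, |heatX c j g (hmul h (hstep c w)) - heatX c j g h| ≤ K * c * rad w) ∧
      (∀ w, |heatY c j g (hmul h (hstep c w)) - heatY c j g h| ≤ K * c * rad w) ∧
      (∀ w, |heatZ c j g (hmul h (hstep c w)) - heatZ c j g h| ≤ K * c * rad w) ∧
      ∃ a₁ b₁ a₂ b₂ : ℝ, a₂ - b₁ = heatZ c j g h ∧
        (∀ w, |heatX c j g (hmul h (hstep c w)) - heatX c j g h
          - c * (a₁ * w.1 + b₁ * w.2)| ≤ K * c ^ 2 * rad w ^ 2) ∧
        (∀ w, |heatY c j g (hmul h (hstep c w)) - heatY c j g h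
          - c * (a₂ * w.1 + b₂ * w.2)| ≤ K * c ^ 2 * rad w ^ 2) := by
  obtain ⟨K₀, k₀, hK₀⟩ := exists_avg_jet g
  obtain ⟨K₁, k₁, hK₁⟩ := exists_avg_jet (schwartzX g)
  obtain ⟨K₂, k₂, hK₂⟩ := exists_avg_jet (schwartzY g)
  obtain ⟨K₃, k₃, hK₃⟩ := exists_avg_jet (schwartzZ g)
  refine ⟨K₀ + K₁ + K₂ + K₃, by positivity, fun c j h hc hj => ?_⟩
  have one : ∀ s : H, |(1 : ℝ)| ≤ hrad s := fun s => by simpa using one_le_hrad s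
  obtain ⟨-, j₀⟩ := hK₀ c j (fun _ => 1) h hc hj measurable_const one
  obtain ⟨l₁, j₁⟩ := hK₁ c j (fun _ => 1) h hc hj measurable_const one
  obtain ⟨l₂, j₂⟩ := hK₂ c j (fun _ => 1) h hc hj measurable_const one
  obtain ⟨l₃, j₃⟩ := hK₃ c j (fun _ => 1) h hc hj measurable_const one
  obtain ⟨la, ja⟩ := hK₃ c j (fun s => s.1) h hc hj (by fun_prop) abs_fst_le_hrad
  obtain ⟨lb, jb⟩ := hK₃ c j (fun s => s.2.1) h hc hj (by fun_prop) abs_snd_le_hrad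
  simp only [avg_one, one_mul] at j₀ j₁ j₂ j₃ l₁ l₂ l₃ ja jb la lb
  have wt : ∀ w : ℝ × ℝ, 0 ≤ c * rad w := fun w => mul_nonneg hc (by linarith [one_le_rad w])
  have wt2 : ∀ w : ℝ × ℝ, 0 ≤ c ^ 2 * rad w ^ 2 := fun w => by positivity
  have up : ∀ {a x y : ℝ}, |a| ≤ x → x ≤ y → |a| ≤ y := fun h₁ h₂ => h₁.trans h₂
  refine ⟨?_, ?_, up l₃ (by linarith), fun w => ?_, fun w => ?_, fun w => ?_, fun w => ?_,
    fun w => ?_, heat c j (schwartzX (schwartzX g)) h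
        + avg c j (fun s => s.2.1) (schwartzZ (schwartzX g)) h
        + (avg c j (fun s => s.2.1) (schwartzX (schwartzZ g)) h
          + avg c j (fun s => s.2.1 * s.2.1) (schwartzZ (schwartzZ g)) h),
      heat c j (schwartzY (schwartzX g)) h
        - avg c j (fun s => s.1) (schwartzZ (schwartzX g)) h
        + (avg c j (fun s => s.2.1) (schwartzY (schwartzZ g)) h
          - avg c j (fun s => s.2.1 * s.1) (schwartzZ (schwartzZ g)) h),
      heat c j (schwartzX (schwartzY g)) h
        + avg c j (fun s => s.2.1) (schwartzZ (schwartzY g)) h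
        - (avg c j (fun s => s.1) (schwartzX (schwartzZ g)) h
          + avg c j (fun s => s.1 * s.2.1) (schwartzZ (schwartzZ g)) h),
      heat c j (schwartzY (schwartzY g)) h
        - avg c j (fun s => s.1) (schwartzZ (schwartzY g)) h
        - (avg c j (fun s => s.1) (schwartzY (schwartzZ g)) h
          - avg c j (fun s => s.1 * s.1) (schwartzZ (schwartzZ g)) h), ?_, fun w => ?_,
      fun w => ?_⟩
  · exact (abs_add_le _ _).trans (by linarith)
  · exact (abs_sub _ _).trans (by linarith)
  · exact up (j₀ w).1 (by nlinarith [wt w])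
  · exact up (j₀ w).2 (by nlinarith [wt2 w])
  · have := abs_add_le (heat c j (schwartzX g) (hmul h (hstep c w)) - heat c j (schwartzX g) h)
      (avg c j (fun s => s.2.1) (schwartzZ g) (hmul h (hstep c w))
        - avg c j (fun s => s.2.1) (schwartzZ g) h)
    have e := this.trans (add_le_add (j₁ w).1 (jb w).1)
    refine le_trans (le_of_eq ?_) (e.trans (by nlinarith [wt w]))
    simp only [heatX]; congr 1; ring
  · have := abs_sub (heat c j (schwartzY g) (hmul h (hstep c w)) - heat c j (schwartzY g) h)
      (avg c j (fun s => s.1) (schwartzZ g) (hmul h (hstep c w))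
        - avg c j (fun s => s.1) (schwartzZ g) h)
    have e := this.trans (add_le_add (j₂ w).1 (ja w).1)
    refine le_trans (le_of_eq ?_) (e.trans (by nlinarith [wt w]))
    simp only [heatY]; congr 1; ring
  · exact up (j₃ w).1 (by nlinarith [wt w])
  · rw [← heat_bracket]
    have zx : (schwartzZ (schwartzX g) : H → ℝ) = schwartzX (schwartzZ g) :=
      funext (schwartzZ_schwartzX g)
    have zy : (schwartzZ (schwartzY g) : H → ℝ) = schwartzY (schwartzZ g) :=
      funext (schwartzZ_schwartzY g)
    have comm : (fun s : H => s.1 * s.2.1) = fun s => s.2.1 * s.1 := by ext s; ring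
    rw [zx, zy, comm]
    ring
  · have e := (abs_add_le _ _).trans (add_le_add (j₁ w).2 (jb w).2)
    refine le_trans (le_of_eq ?_) (e.trans (by nlinarith [wt2 w]))
    simp only [heatX]; congr 1; ring
  · have e := (abs_sub _ _).trans (add_le_add (j₂ w).2 (ja w).2)
    refine le_trans (le_of_eq ?_) (e.trans (by nlinarith [wt2 w]))
    simp only [heatY]; congr 1; ring

/-- The norm of the gradient of `g` for the metric `X² + Y² + ν Z²`. -/
def gradNrm (ν : ℝ) (g : 𝓢(H, ℝ)) (p : H) : ℝ :=
  nrm ν (schwartzX g p) (schwartzY g p) (schwartzZ g p)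

lemma measurable_gradNrm (ν : ℝ) (g : 𝓢(H, ℝ)) : Measurable (gradNrm ν g) :=
  measurable_nrm (measurable_schwartz _) (measurable_schwartz _) (measurable_schwartz _)

lemma exists_gradNrm_le {ν : ℝ} (hν : 0 < ν) (g : 𝓢(H, ℝ)) :
    ∃ K, 0 ≤ K ∧ ∀ p, |gradNrm ν g p| ≤ K := by
  obtain ⟨K₁, k₁, hK₁⟩ := schwartz_bounded (schwartzX g)
  obtain ⟨K₂, k₂, hK₂⟩ := schwartz_bounded (schwartzY g)
  obtain ⟨K₃, k₃, hK₃⟩ := schwartz_bounded (schwartzZ g)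
  refine ⟨(K₁ + K₂ + K₃) * (2 + √ν), by positivity, fun p => ?_⟩
  rw [gradNrm, abs_of_nonneg (nrm_nonneg _ _ _ _)]
  exact nrm_le hν (Real.sq_sqrt hν.le) (Real.sqrt_nonneg _) ((hK₁ p).trans (by linarith))
    ((hK₂ p).trans (by linarith)) ((hK₃ p).trans (by linarith))

lemma measurable_right_hstep (h : H) (c : ℝ) : Measurable fun w => hmul h (hstep c w) :=
  (measurable_hmul_left h).comp (continuous_hstep c).measurable

lemma exists_nrm_heat_le {ν : ℝ} (hν : 0 < ν) (g : 𝓢(H, ℝ)) :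
    ∃ C, 0 ≤ C ∧ ∀ (c : ℝ) (j : ℕ) (h : H), 0 ≤ c → c ≤ 1 → c ^ 2 * j ≤ 1 →
      nrm ν (heatX c j g h) (heatY c j g h) (heatZ c j g h)
        ≤ (1 + c ^ 2 / ν / 2) ^ j * (heat c j (gradNrm ν g) h + j * (C * c ^ 3)) := by
  obtain ⟨K, k, hK⟩ := exists_heat_jet g
  obtain ⟨R, r, hR⟩ := exists_gradNrm_le hν g
  obtain ⟨C, hC, step⟩ := exists_nrm_integral_step_le hν k
  refine ⟨C, hC, fun c j => ?_⟩
  induction j with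
  | zero =>
    intro h hc hc1 hj
    simp [heatX_zero, heatY_zero, heatZ_zero, heat_zero, gradNrm]
  | succ j ih =>
    intro h hc hc1 hj
    have hj' := le_one_of_succ hj
    obtain ⟨-, -, -, -, -, lx, ly, lz, a₁, b₁, a₂, b₂, hab, tx, ty⟩ := hK c j h hc hj'
    have mw := measurable_right_hstep h c
    have st := step c (fun w => heatX c j g (hmul h (hstep c w)))
      (fun w => heatY c j g (hmul h (hstep c w))) (fun w => heatZ c j g (hmul h (hstep c w)))
      _ _ _ a₁ b₁ a₂ b₂ hc hc1 ((measurable_heatX c j g).comp mw)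
      ((measurable_heatY c j g).comp mw) ((measurable_heatZ c j g).comp mw)
      (fun w => (hK c j _ hc hj').1) (fun w => (hK c j _ hc hj').2.1)
      (fun w => (hK c j _ hc hj').2.2.1) tx ty lx ly lz hab
    rw [← heatX_succ hj, ← heatY_succ hj, ← heatZ_succ] at st
    set q := 1 + c ^ 2 / ν / 2 with hq
    have q1 : 1 ≤ q := by rw [hq]; have : 0 ≤ c ^ 2 / ν / 2 := by positivity
                          linarith
    have ih1 : Integrable (fun w => heat c j (gradNrm ν g) (hmul h (hstep c w))) planeGauss :=
      integrable_of_bounded ((measurable_heat c j (measurable_gradNrm ν g)).comp mw) R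
        fun w => abs_heat_le c j hR _
    have i2 : Integrable (fun w => q ^ j * (heat c j (gradNrm ν g) (hmul h (hstep c w))
        + j * (C * c ^ 3))) planeGauss := (ih1.add (integrable_const _)).const_mul _
    have i1 : Integrable (fun w => nrm ν (heatX c j g (hmul h (hstep c w)))
        (heatY c j g (hmul h (hstep c w))) (heatZ c j g (hmul h (hstep c w)))) planeGauss := by
      refine integrable_of_bounded (measurable_nrm ((measurable_heatX c j g).comp mw)
        ((measurable_heatY c j g).comp mw) ((measurable_heatZ c j g).comp mw))
        (K * (2 + √ν)) fun w => ?_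
      rw [abs_of_nonneg (nrm_nonneg _ _ _ _)]
      exact nrm_le hν (Real.sq_sqrt hν.le) (Real.sqrt_nonneg _) (hK c j _ hc hj').1
        (hK c j _ hc hj').2.1 (hK c j _ hc hj').2.2.1
    have mono := integral_mono i1 i2 fun w => ih (hmul h (hstep c w)) hc hc1 hj'
    rw [integral_const_mul, integral_add ih1 (integrable_const _), ← heat_succ c j
      (measurable_gradNrm ν g) hR] at mono
    simp only [integral_const, probReal_univ, one_smul] at mono
    have qj : 1 ≤ q ^ (j + 1) := one_le_pow₀ q1
    have hc3 : 0 ≤ C * c ^ 3 := by positivity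
    refine st.trans ((add_le_add_left (mul_le_mul_of_nonneg_left mono (by linarith)) _).trans ?_)
    rw [← mul_assoc, ← pow_succ', Nat.cast_succ]
    have := mul_le_mul_of_nonneg_right qj hc3
    linear_combination this

/-- The carré du champ of `f` for the metric `X² + Y² + ν Z²`. -/
def carre (ν : ℝ) (f : 𝓢(H, ℝ)) : 𝓢(H, ℝ) :=
  schwartzMul (schwartzX f) (schwartzX f) + schwartzMul (schwartzY f) (schwartzY f)
    + ν • schwartzMul (schwartzZ f) (schwartzZ f)

lemma carre_apply (ν : ℝ) (f : 𝓢(H, ℝ)) (p : H) :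
    carre ν f p = schwartzX f p ^ 2 + schwartzY f p ^ 2 + ν * schwartzZ f p ^ 2 := by
  simp [carre, schwartzMul_apply]; ring

lemma carre_nonneg {ν : ℝ} (hν : 0 < ν) (f : 𝓢(H, ℝ)) (p : H) : 0 ≤ carre ν f p := by
  rw [carre_apply]; positivity

lemma gradNrm_schwartzMul_self (ν : ℝ) (f : 𝓢(H, ℝ)) (p : H) :
    gradNrm ν (schwartzMul f f) p = 2 * |f p| * √(carre ν f p) := by
  have e : ((2 * f p * schwartzX f p) ^ 2 + (2 * f p * schwartzY f p) ^ 2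
      + ν * (2 * f p * schwartzZ f p) ^ 2) = (2 * |f p|) ^ 2 * carre ν f p := by
    rw [carre_apply, mul_pow 2 |f p|, sq_abs]; ring
  rw [gradNrm, nrm]
  simp only [schwartzX_apply, schwartzY_apply, schwartzZ_apply, fderiv_schwartzMul_self] at e ⊢
  rw [e, Real.sqrt_mul (by positivity), Real.sqrt_sq (by positivity)]

lemma sq_heat_gradNrm_le {ν ε : ℝ} (hν : 0 < ν) (hε : 0 < ε) (f : 𝓢(H, ℝ)) (c : ℝ) (j : ℕ)
    (h : H) : heat c j (gradNrm ν (schwartzMul f f)) h ^ 2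
      ≤ 4 * (heat c j (schwartzMul f f) h + ε) * heat c j (carre ν f) h := by
  obtain ⟨R, -, hR⟩ := exists_gradNrm_le hν (schwartzMul f f)
  set ρ := heat c j (gradNrm ν (schwartzMul f f)) h with hρ
  have c0 := carre_nonneg hν f
  have g0 : 0 ≤ heat c j (schwartzMul f f) h :=
    integral_nonneg fun s => by simp only [schwartzMul_apply]; exact mul_self_nonneg _
  have Γ0 : 0 ≤ heat c j (carre ν f) h := integral_nonneg fun s => c0 _
  have ρ0 : 0 ≤ ρ := integral_nonneg fun s => nrm_nonneg _ _ _ _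
  rcases ρ0.eq_or_lt with h0 | h0
  · rw [← h0, zero_pow two_ne_zero]; positivity
  set A := heat c j (schwartzMul f f) h + ε with hA
  have A0 : 0 < A := by linarith
  set t := ρ / (2 * A) with ht
  have t0 : 0 < t := by positivity
  have i₁ := (integrable_heat_schwartz c j (schwartzMul f f) h).const_mul t
  have i₂ := (integrable_heat_schwartz c j (carre ν f) h).const_mul t⁻¹
  have key : ρ ≤ t * heat c j (schwartzMul f f) h + t⁻¹ * heat c j (carre ν f) h := by
    rw [hρ, heat, heat, heat, ← integral_const_mul, ← integral_const_mul, ← integral_add i₁ i₂]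
    refine integral_mono (integrable_heat c j (measurable_gradNrm _ _) hR h) (i₁.add i₂)
      fun s => ?_
    simp only [gradNrm_schwartzMul_self, schwartzMul_apply]
    set p := hmul h s
    have hs := Real.sq_sqrt (c0 p)
    set z := √(carre ν f p)
    rw [← hs, ← abs_mul_abs_self (f p)]
    have := sq_nonneg (t * |f p| - z)
    have e : t * (|f p| * |f p|) + t⁻¹ * z ^ 2 - 2 * |f p| * z
        = t⁻¹ * (t * |f p| - z) ^ 2 := by field_simp; ring
    have : 0 ≤ t⁻¹ * (t * |f p| - z) ^ 2 := by positivity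
    linarith
  have k2 : ρ ≤ ρ / 2 + 2 * A / ρ * heat c j (carre ν f) h := by
    refine key.trans (add_le_add ?_ (le_of_eq ?_))
    · calc _ ≤ t * A := mul_le_mul_of_nonneg_left (by linarith) t0.le
        _ = ρ / 2 := by rw [ht]; field_simp
    · rw [ht, inv_div]
  have k3 := mul_le_mul_of_nonneg_right k2 h0.le
  have : (ρ / 2 + 2 * A / ρ * heat c j (carre ν f) h) * ρ
      = ρ ^ 2 / 2 + 2 * A * heat c j (carre ν f) h := by field_simp
  nlinarith

lemma exists_sq_heatXY_div_le {ν ε : ℝ} (hν : 0 < ν) (hε : 0 < ε) (f : 𝓢(H, ℝ)) :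
    ∃ C, 0 ≤ C ∧ ∀ (c : ℝ) (j : ℕ) (h : H), 0 ≤ c → c ≤ 1 → c ^ 2 * j ≤ 1 →
      (heatX c j (schwartzMul f f) h ^ 2 + heatY c j (schwartzMul f f) h ^ 2)
          / (2 * (heat c j (schwartzMul f f) h + ε))
        ≤ 2 * Real.exp (c ^ 2 / ν * j) * heat c j (carre ν f) h + C * c := by
  set G := schwartzMul f f with hG
  obtain ⟨C, hC, hN⟩ := exists_nrm_heat_le hν G
  obtain ⟨R, hR0, hR⟩ := exists_gradNrm_le hν G
  refine ⟨Real.exp (1 / ν) * (2 * R * C + C ^ 2) / (2 * ε), by positivity,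
    fun c j h hc hc1 hj => ?_⟩
  have g0 : 0 ≤ heat c j G h :=
    integral_nonneg fun s => by simp only [hG, schwartzMul_apply]; exact mul_self_nonneg _
  have hN := hN c j h hc hc1 hj
  have cs := sq_heat_gradNrm_le hν hε f c j h
  have N0 := nrm_nonneg ν (heatX c j G h) (heatY c j G h) (heatZ c j G h)
  have N2 := nrm_sq hν (heatX c j G h) (heatY c j G h) (heatZ c j G h)
  have ρ0 : 0 ≤ heat c j (gradNrm ν G) h := integral_nonneg fun s => nrm_nonneg _ _ _ _
  have ρR : heat c j (gradNrm ν G) h ≤ R := (le_abs_self _).trans (abs_heat_le c j hR h)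
  rw [← hG] at cs
  set N := nrm ν (heatX c j G h) (heatY c j G h) (heatZ c j G h)
  set ρ := heat c j (gradNrm ν G) h
  set g := heat c j G h
  set Γ := heat c j (carre ν f) h
  have e1 : (1 + c ^ 2 / ν / 2) ^ j ≤ Real.exp (c ^ 2 / ν / 2 * j) := by
    rw [mul_comm, Real.exp_nat_mul]
    exact pow_le_pow_left₀ (by positivity) (by linarith [Real.add_one_le_exp (c ^ 2 / ν / 2)]) _
  have e2 : Real.exp (c ^ 2 / ν / 2 * j) ^ 2 = Real.exp (c ^ 2 / ν * j) := by
    rw [← Real.exp_nat_mul]; congr 1; push_cast; ring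
  have e3 : Real.exp (c ^ 2 / ν * j) ≤ Real.exp (1 / ν) := by
    refine Real.exp_le_exp.2 ?_
    rw [div_mul_eq_mul_div]
    exact div_le_div_of_nonneg_right hj hν.le
  have jc : j * (C * c ^ 3) ≤ C * c := by
    have := mul_le_mul_of_nonneg_right hj (mul_nonneg hC hc)
    linarith [show c ^ 2 * j * (C * c) = j * (C * c ^ 3) by ring]
  have hN' : N ≤ Real.exp (c ^ 2 / ν / 2 * j) * (ρ + C * c) :=
    hN.trans (mul_le_mul e1 (by linarith) (by positivity) (Real.exp_nonneg _))
  have sq := pow_le_pow_left₀ N0 hN' 2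
  rw [mul_pow, e2, N2] at sq
  set e := Real.exp (c ^ 2 / ν * j)
  have e0 : 0 ≤ e := Real.exp_nonneg _
  have rest : e * (2 * ρ * (C * c) + (C * c) ^ 2) ≤ Real.exp (1 / ν) * (2 * R * C + C ^ 2) * c := by
    rw [mul_assoc (Real.exp _)]
    refine mul_le_mul e3 ?_ (by positivity) (Real.exp_nonneg _)
    have h1 : ρ * (C * c) ≤ R * (C * c) := mul_le_mul_of_nonneg_right ρR (by positivity)
    have h2 : c ^ 2 ≤ c := by nlinarith
    have h3 := mul_le_mul_of_nonneg_left h2 (sq_nonneg C)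
    rw [mul_pow]; linarith
  have hXY : heatX c j G h ^ 2 + heatY c j G h ^ 2
      ≤ e * (4 * (g + ε) * Γ) + Real.exp (1 / ν) * (2 * R * C + C ^ 2) * c := by
    have h1 := mul_le_mul_of_nonneg_left cs e0
    have h2 : 0 ≤ ν * heatZ c j G h ^ 2 := by positivity
    linarith [show e * (ρ + C * c) ^ 2 = e * ρ ^ 2 + e * (2 * ρ * (C * c) + (C * c) ^ 2) by ring]
  have gε : 0 < g + ε := by linarith
  refine (div_le_div_of_nonneg_right hXY (by positivity)).trans ?_
  rw [add_div]
  refine add_le_add (le_of_eq (by field_simp; ring)) ?_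
  rw [div_mul_eq_mul_div]
  exact div_le_div_of_nonneg_left (by positivity) (by positivity) (by linarith)

lemma exists_heat_le_heat_succ (g : 𝓢(H, ℝ)) :
    ∃ C, 0 ≤ C ∧ ∀ (c : ℝ) (j : ℕ) (h : H), 0 ≤ c → c ^ 2 * j ≤ 1 →
      heat c j g h ≤ heat c (j + 1) g h + C * c := by
  obtain ⟨K, k, hK⟩ := exists_heat_jet g
  obtain ⟨R, -, hR⟩ := schwartz_bounded g
  have T0 := radMoment_nonneg
  refine ⟨K * radMoment, by positivity, fun c j h hc hj => ?_⟩
  obtain ⟨-, -, -, l, -⟩ := hK c j h hc hj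
  have i : Integrable (fun w => heat c j g (hmul h (hstep c w))) planeGauss :=
    integrable_of_bounded ((measurable_heat c j (measurable_schwartz g)).comp
      (measurable_right_hstep h c)) R fun w => abs_heat_le c j hR _
  have := abs_integral_le_rad (φ := fun w => heat c j g (hmul h (hstep c w)) - heat c j g h)
    (K * c) fun w => (l w).trans (mul_le_mul_of_nonneg_left
      (by simpa using rad_pow_le w (show 1 ≤ 6 by norm_num)) (by positivity))
  rw [integral_sub i (integrable_const _), ← heat_succ c j (measurable_schwartz g) hR] at this
  simp only [integral_const, probReal_univ, one_smul] at this
  linarith [(abs_le.1 this).1]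

lemma exists_heat_entropy_step_le {ν ε : ℝ} (hν : 0 < ν) (hε : 0 < ε) (f : 𝓢(H, ℝ)) :
    ∃ C, 0 ≤ C ∧ ∀ (c : ℝ) (j : ℕ) (h : H), 0 ≤ c → c ≤ 1 → c ^ 2 * j ≤ 1 →
      ∫ w, (heat c j (schwartzMul f f) (hmul h (hstep c w)) + ε)
          * Real.log (heat c j (schwartzMul f f) (hmul h (hstep c w)) + ε) ∂planeGauss
        - (heat c (j + 1) (schwartzMul f f) h + ε)
          * Real.log (heat c (j + 1) (schwartzMul f f) h + ε)
        ≤ 2 * c ^ 2 * Real.exp (c ^ 2 / ν * j) * heat c (j + 1) (carre ν f) h + C * c ^ 3 := by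
  set G := schwartzMul f f with hG
  obtain ⟨K, k, hK⟩ := exists_heat_jet G
  obtain ⟨R, r, hR⟩ := schwartz_bounded G
  obtain ⟨C₁, hC₁, h₁⟩ := exists_entropy_step_le hε (K := K + R + ε) (by positivity)
  obtain ⟨C₂, hC₂, h₂⟩ := exists_sq_heatXY_div_le hν hε f
  obtain ⟨C₃, hC₃, h₃⟩ := exists_heat_le_heat_succ (carre ν f)
  refine ⟨C₁ + C₂ + 2 * Real.exp (1 / ν) * C₃, by positivity, fun c j h hc hc1 hj => ?_⟩
  have g0 : ∀ p, 0 ≤ heat c j G p := fun p =>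
    integral_nonneg fun s => by simp only [hG, schwartzMul_apply]; exact mul_self_nonneg _
  have gR : ∀ p, heat c j G p ≤ R := fun p => (le_abs_self _).trans (abs_heat_le c j hR p)
  obtain ⟨bx, bY, -, l, t, -⟩ := hK c j h hc hj
  have mg := (measurable_heat c j (measurable_schwartz G)).comp (measurable_right_hstep h c)
  have ig : Integrable (fun w => heat c j G (hmul h (hstep c w))) planeGauss :=
    integrable_of_bounded mg R fun w => abs_heat_le c j hR _
  have hKw : ∀ w, 0 ≤ rad w := fun w => zero_le_one.trans (one_le_rad w)
  have st := h₁ c (fun w => heat c j G (hmul h (hstep c w)) + ε) (heat c j G h + ε)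
    (heatX c j G h) (heatY c j G h) hc hc1 (mg.add_const _)
    (fun w => by linarith [g0 (hmul h (hstep c w))])
    (fun w => by linarith [gR (hmul h (hstep c w))]) (by linarith [g0 h]) (by linarith)
    (by linarith)
    (fun w => by
      rw [add_sub_add_right_eq_sub]
      refine (t w).trans ?_
      have := hKw w
      gcongr; linarith)
    (fun w => by
      rw [add_sub_add_right_eq_sub]
      refine (l w).trans ?_
      have := hKw w
      gcongr; linarith)
  rw [integral_add ig (integrable_const _), ← heat_succ c j (measurable_schwartz G) hR] at st
  simp only [integral_const, probReal_univ, one_smul] at st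
  have s₂ := mul_le_mul_of_nonneg_left (h₂ c j h hc hc1 hj) (sq_nonneg c)
  rw [← mul_div_assoc] at s₂
  have e3 : Real.exp (c ^ 2 / ν * j) ≤ Real.exp (1 / ν) := by
    refine Real.exp_le_exp.2 ?_
    rw [div_mul_eq_mul_div]
    exact div_le_div_of_nonneg_right hj hν.le
  have s₃ := mul_le_mul_of_nonneg_left (h₃ c j h hc hj)
    (show 0 ≤ 2 * c ^ 2 * Real.exp (c ^ 2 / ν * j) by positivity)
  have s₄ := mul_le_mul_of_nonneg_left e3 (show 0 ≤ 2 * C₃ * c ^ 3 by positivity)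
  linarith

/-- Entropy inequality for the random walk started at `h`, up to an error of order `j c³`. -/
lemma exists_entropy_heat_le {ν ε : ℝ} (hν : 0 < ν) (hε : 0 < ε) (f : 𝓢(H, ℝ)) :
    ∃ C, 0 ≤ C ∧ ∀ (c : ℝ) (j : ℕ) (h : H), 0 ≤ c → c ≤ 1 → c ^ 2 * j ≤ 1 →
      heat c j (fun p => (schwartzMul f f p + ε) * Real.log (schwartzMul f f p + ε)) h
        - (heat c j (schwartzMul f f) h + ε) * Real.log (heat c j (schwartzMul f f) h + ε)
        ≤ 2 * c ^ 2 * (∑ i ∈ Finset.range j, Real.exp (c ^ 2 / ν * i)) * heat c j (carre ν f) h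
          + j * (C * c ^ 3) := by
  obtain ⟨C, hC, step⟩ := exists_heat_entropy_step_le hν hε f
  refine ⟨C, hC, fun c j => ?_⟩
  set G := schwartzMul f f with hG
  set Φ : H → ℝ := fun p => (G p + ε) * Real.log (G p + ε) with hΦ
  obtain ⟨R, r, hR⟩ := schwartz_bounded G
  obtain ⟨S, -, hS⟩ := schwartz_bounded (carre ν f)
  have G0 : ∀ p, 0 ≤ G p := fun p => by simp only [hG, schwartzMul_apply]; exact mul_self_nonneg _
  have mG := measurable_schwartz G
  have mΦ : Measurable Φ := (mG.add_const _).mul (mG.add_const _).log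
  have bΦ : ∀ p, |Φ p| ≤ 1 + (R + ε) ^ 2 := fun p =>
    abs_mul_log_le (by linarith [G0 p]) (by linarith [le_abs_self (G p), hR p])
  induction j with
  | zero =>
    intro h hc hc1 hj
    simp [heat_zero, hΦ]
  | succ j ih =>
    intro h hc hc1 hj
    have hj' := le_one_of_succ hj
    have mw := measurable_right_hstep h c
    have st := step c j h hc hc1 hj'
    have g0 : ∀ p, 0 ≤ heat c j G p := fun p => integral_nonneg fun s => G0 _
    have gR : ∀ p, heat c j G p ≤ R := fun p => (le_abs_self _).trans (abs_heat_le c j hR p)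
    have mg := ((measurable_heat c j mG).comp mw).add_const ε
    have i₁ : Integrable (fun w => heat c j Φ (hmul h (hstep c w))) planeGauss :=
      integrable_of_bounded ((measurable_heat c j mΦ).comp mw) _ fun w => abs_heat_le c j bΦ _
    have i₂ : Integrable (fun w => (heat c j G (hmul h (hstep c w)) + ε)
        * Real.log (heat c j G (hmul h (hstep c w)) + ε)) planeGauss :=
      integrable_of_bounded (mg.mul mg.log) _ fun w => abs_mul_log_le (K := R + ε)
        (by linarith [g0 (hmul h (hstep c w))]) (by linarith [gR (hmul h (hstep c w))])
    have i₃ : Integrable (fun w => heat c j (carre ν f) (hmul h (hstep c w))) planeGauss :=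
      integrable_of_bounded ((measurable_heat c j (measurable_schwartz _)).comp mw) _
        fun w => abs_heat_le c j hS _
    have mono := integral_mono (i₁.sub i₂) ((i₃.const_mul _).add (integrable_const _))
      fun w => ih (hmul h (hstep c w)) hc hc1 hj'
    simp only [Pi.sub_apply, Pi.add_apply] at mono
    rw [integral_sub i₁ i₂, integral_add (i₃.const_mul _) (integrable_const _),
      integral_const_mul, ← heat_succ c j mΦ bΦ, ← heat_succ c j (measurable_schwartz _) hS] at mono
    simp only [integral_const, probReal_univ, one_smul] at mono
    rw [Finset.sum_range_succ, Nat.cast_succ]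
    linarith

lemma heat_zero_right (c : ℝ) (n : ℕ) (g : H → ℝ) : heat c n g 0 = ∫ p, g p ∂(walk c n) := by
  simp [heat, hmul]

lemma mul_sum_exp_le {x : ℝ} (n : ℕ) :
    x * ∑ i ∈ Finset.range n, Real.exp (x * i) ≤ Real.exp (x * n) - 1 := by
  have e : ∀ m : ℕ, Real.exp (x * m) = Real.exp x ^ m := fun m => by
    rw [mul_comm, Real.exp_nat_mul]
  simp only [e]
  rw [← geom_sum_mul, mul_comm]
  exact mul_le_mul_of_nonneg_left (by linarith [Real.add_one_le_exp x])
    (Finset.sum_nonneg fun i _ => by positivity)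

lemma exists_entropy_nuMeas_le {ν ε : ℝ} (hν : 0 < ν) (hε : 0 < ε) (f : 𝓢(H, ℝ)) :
    ∃ C, ∀ n : ℕ, 1 ≤ n →
      ∫ p, (schwartzMul f f p + ε) * Real.log (schwartzMul f f p + ε) ∂(nuMeas 0 n)
        - (∫ p, schwartzMul f f p ∂(nuMeas 0 n) + ε)
          * Real.log (∫ p, schwartzMul f f p ∂(nuMeas 0 n) + ε)
        ≤ 2 * ν * (Real.exp (1 / ν) - 1) * ∫ p, carre ν f p ∂(nuMeas 0 n)
          + C * (n : ℝ) ^ (-(1 : ℝ) / 2) := by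
  obtain ⟨C, hC, key⟩ := exists_entropy_heat_le hν hε f
  refine ⟨C, fun n hn => ?_⟩
  rw [nuMeas_zero_eq_walk]
  have n1 : (1 : ℝ) ≤ n := by exact_mod_cast hn
  set c := (n : ℝ) ^ (-(1 : ℝ) / 2) with hc
  have c0 : 0 ≤ c := by positivity
  have cn : c ^ 2 * n = 1 := by
    rw [hc, ← Real.rpow_natCast, ← Real.rpow_mul (by positivity)]
    norm_num [Real.rpow_neg_one]
    field_simp
  have c1 : c ≤ 1 := Real.rpow_le_one_of_one_le_of_nonpos n1 (by norm_num)
  have k := key c n 0 c0 c1 cn.le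
  simp only [heat_zero_right] at k
  refine k.trans (add_le_add (mul_le_mul_of_nonneg_right ?_
    (integral_nonneg fun p => carre_nonneg hν f p)) (le_of_eq ?_))
  · have s := mul_sum_exp_le (x := c ^ 2 / ν) n
    rw [div_mul_eq_mul_div (c ^ 2) ν (n : ℝ), cn, div_mul_eq_mul_div, div_le_iff₀ hν] at s
    linarith
  · linear_combination C * c * cn

lemma continuous_mul_log_add (f : 𝓢(H, ℝ)) (ε : ℝ) :
    Continuous fun p => (schwartzMul f f p + ε) * Real.log (schwartzMul f f p + ε) :=
  Real.continuous_mul_log.comp ((schwartzMul f f).continuous.add continuous_const)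

lemma abs_mul_log_add_le {f : 𝓢(H, ℝ)} {ε R : ℝ} (hε : 0 < ε)
    (hR : ∀ p, |schwartzMul f f p| ≤ R) (p : H) :
    |(schwartzMul f f p + ε) * Real.log (schwartzMul f f p + ε)| ≤ 1 + (R + ε) ^ 2 := by
  refine abs_mul_log_le ?_ (by linarith [(le_abs_self _).trans (hR p)])
  rw [schwartzMul_apply]
  linarith [mul_self_nonneg (f p)]

lemma entropy_add_const_le {γ : Measure H} [IsProbabilityMeasure γ]
    (hγ : ∀ g : BoundedContinuousFunction H ℝ,
      Filter.Tendsto (fun n : ℕ => ∫ h, g h ∂(nuMeas 0 n))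
        Filter.atTop (nhds (∫ h, g h ∂γ)))
    {ν ε : ℝ} (hν : 0 < ν) (hε : 0 < ε) (f : 𝓢(H, ℝ)) :
    ∫ p, (schwartzMul f f p + ε) * Real.log (schwartzMul f f p + ε) ∂γ
        - (∫ p, schwartzMul f f p ∂γ + ε) * Real.log (∫ p, schwartzMul f f p ∂γ + ε)
      ≤ 2 * ν * (Real.exp (1 / ν) - 1) * ∫ p, carre ν f p ∂γ := by
  have lim : ∀ {F : H → ℝ} {K : ℝ}, Continuous F → (∀ p, |F p| ≤ K) →
      Filter.Tendsto (fun n : ℕ => ∫ p, F p ∂(nuMeas 0 n)) Filter.atTop (nhds (∫ p, F p ∂γ)) :=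
    fun {F K} hF hK => hγ (BoundedContinuousFunction.ofNormedAddCommGroup F hF K hK)
  obtain ⟨R, r, hR⟩ := schwartz_bounded (schwartzMul f f)
  obtain ⟨S, -, hS⟩ := schwartz_bounded (carre ν f)
  obtain ⟨C, key⟩ := exists_entropy_nuMeas_le hν hε f
  have l₁ := lim (continuous_mul_log_add f ε) (abs_mul_log_add_le hε hR)
  have l₂ := (lim (schwartzMul f f).continuous hR).add_const ε
  have l₃ := lim (carre ν f).continuous hS
  have l₄ : Filter.Tendsto (fun n : ℕ => (n : ℝ) ^ (-(1 : ℝ) / 2)) Filter.atTop (nhds 0) := by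
    rw [neg_div]
    exact (tendsto_rpow_neg_atTop (by norm_num)).comp tendsto_natCast_atTop_atTop
  have := le_of_tendsto_of_tendsto (l₁.sub ((Real.continuous_mul_log.tendsto _).comp l₂))
    ((l₃.const_mul _).add (l₄.const_mul C)) (Filter.eventually_atTop.2 ⟨1, key⟩)
  simpa using this

theorem baudoin_garofalo_lsi (γ : Measure H) [IsProbabilityMeasure γ]
    (hγ : ∀ g : BoundedContinuousFunction H ℝ,
      Filter.Tendsto (fun n : ℕ => ∫ h, g h ∂(nuMeas 0 n))
        Filter.atTop (nhds (∫ h, g h ∂γ))) :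
    ∀ ν : ℝ, 0 < ν → ∀ f : SchwartzMap H ℝ,
      Ent γ (fun h => f h ^ 2) ≤
        2 * ν * (Real.exp (1 / ν) - 1) *
          ∫ h, ((Xop f h) ^ 2 + (Yop f h) ^ 2 + ν * (Zop f h) ^ 2) ∂γ := by
  intro ν hν f
  obtain ⟨R, r, hR⟩ := schwartz_bounded (schwartzMul f f)
  have eG : (fun h => f h ^ 2) = schwartzMul f f := by
    funext p; rw [schwartzMul_apply, pow_two]
  simp only [Xop_schwartz, Yop_schwartz, Zop_schwartz, ← carre_apply]
  rw [eG, Ent]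
  have small : ∀ᶠ ε in nhdsWithin (0 : ℝ) (Set.Ioi 0), ε ∈ Set.Ioo (0 : ℝ) 1 :=
    Ioo_mem_nhdsGT one_pos
  have t0 : Filter.Tendsto (fun ε : ℝ => ε) (nhdsWithin 0 (Set.Ioi 0)) (nhds 0) :=
    Filter.tendsto_id.mono_left nhdsWithin_le_nhds
  have l₁ : Filter.Tendsto
      (fun ε => ∫ p, (schwartzMul f f p + ε) * Real.log (schwartzMul f f p + ε) ∂γ)
      (nhdsWithin 0 (Set.Ioi 0))
      (nhds (∫ p, schwartzMul f f p * Real.log (schwartzMul f f p) ∂γ)) := by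
    refine tendsto_integral_filter_of_dominated_convergence (fun _ => 1 + (R + 1) ^ 2)
      (Filter.Eventually.of_forall fun ε =>
        (continuous_mul_log_add f ε).measurable.aestronglyMeasurable) ?_ (integrable_const _) ?_
    · filter_upwards [small] with ε hε
      refine Filter.Eventually.of_forall fun p => (abs_mul_log_add_le hε.1 hR p).trans ?_
      have := hε.1
      have := hε.2.le
      gcongr
    · refine Filter.Eventually.of_forall fun p => ?_
      have := (Real.continuous_mul_log.tendsto _).comp (t0.const_add (schwartzMul f f p))
      simpa [Function.comp_def] using this
  have l₂ := (Real.continuous_mul_log.tendsto _).comp (t0.const_add (∫ p, schwartzMul f f p ∂γ))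
  rw [add_zero] at l₂
  refine le_of_tendsto (l₁.sub l₂) ?_
  filter_upwards [small] with ε hε
  exact entropy_add_const_le hγ hν hε.1 f

end
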